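/- Fix a binary tree B with |B| leaves. The probability that one of the two root branches of the left tree of a uniformly random tanglegram of size n is isomorphic to B converges, as n → ∞, to 2^{−|B|}/|A(B)|. In particular, the limiting probability that one of the root branches of the left tree is a single leaf is 1/2. -/

import Mathlib

open scoped Classical

inductive PTree : Type
  | leaf : PTree
  | node : PTree → PTree → PTree
deriving DecidableEq

namespace PTree

def size : PTree → ℕ
  | leaf => 1
  | node l r => size l + size r

def cherries : PTree → ℕ
  | leaf => 0
  | node leaf leaf => 1
  | node l r => cherries l + cherries r

def height : PTree → ℕ
  | leaf => 0
  | node l r => max (height l) (height r) + 1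

def encode : PTree → ℕ
  | leaf => 0
  | node l r => Nat.pair (encode l) (encode r) + 1

def normalize : PTree → PTree
  | leaf => leaf
  | node l r =>
      let l' := normalize l
      let r' := normalize r
      if encode l' ≤ encode r' then node l' r' else node r' l'

def isoFuns : PTree → PTree → List (ℕ → ℕ)
  | leaf, leaf => [fun i => i]
  | node l r, node l' r' =>
      ((isoFuns l l').flatMap fun g => (isoFuns r r').map fun h =>
        fun i => if i < l.size then g i else h (i - l.size) + l'.size)
      ++
      ((isoFuns l r').flatMap fun g => (isoFuns r l').map fun h =>
        fun i => if i < l.size then g i + l'.size else h (i - l.size))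
  | _, _ => []

def planeTrees : ℕ → Finset PTree
  | 0 => ∅
  | 1 => {leaf}
  | n + 2 =>
      (Finset.range (n + 1)).attach.biUnion fun k =>
        ((planeTrees (k.1 + 1)) ×ˢ (planeTrees (n + 1 - k.1))).image
          fun p => node p.1 p.2
  termination_by n => n
  decreasing_by
  · have := Finset.mem_range.mp k.2; omega
  · omega

def binTrees (n : ℕ) : Finset PTree := (planeTrees n).image normalize

/-- Triples (T, v, S): left plane tree, right plane tree, and a matching `v`
(a permutation of `0, …, n-1`, encoded as the list of its values) matching
leaf `i` of `T` with leaf `v i` of `S`. -/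
def Triples (n : ℕ) : Finset (PTree × PTree × List ℕ) :=
  (planeTrees n) ×ˢ ((planeTrees n) ×ˢ (List.range n).permutations.toFinset)

/-- Two triples represent the same tanglegram iff there are isomorphisms of the left
trees and of the right trees compatible with the matchings. -/
def equivTriple (n : ℕ) (t t' : PTree × PTree × List ℕ) : Bool :=
  (isoFuns t.1 t'.1).any fun φ => (isoFuns t.2.1 t'.2.1).any fun ψ =>
    (List.range n).all fun i => t'.2.2.getD (φ i) 0 == ψ (t.2.2.getD i 0)

/-- The tanglegrams of size `n`: equivalence classes of triples. -/
def tangleClasses (n : ℕ) : Finset (Finset (PTree × PTree × List ℕ)) :=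
  (Triples n).image fun t => (Triples n).filter (fun t' => equivTriple n t t' = true)

/-- The number of tanglegrams of size `n`. -/
def numTanglegrams (n : ℕ) : ℕ := (tangleClasses n).card

/-- The probability that a uniformly random tanglegram of size `n` satisfies the
(isomorphism-invariant) property `P` of triples. -/
noncomputable def tangleProb (n : ℕ) (P : PTree × PTree × List ℕ → Prop) : ℝ :=
  ((tangleClasses n).filter fun c => ∃ t ∈ c, P t).card / numTanglegrams n

/-- The expectation of the statistic `f` of a uniformly random tanglegram of size `n`. -/
noncomputable def tangleExp (n : ℕ) (f : PTree × PTree × List ℕ → ℕ) : ℝ :=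
  ∑' k : ℕ, (k : ℝ) * tangleProb n (fun t => f t = k)

end PTree

namespace PTree

/-- The distribution on pairs of binary trees (canonical representatives) induced by
the two halves of a uniformly random tanglegram of size `n`:
probability that the pair of isomorphism classes of the two trees lies in `S`. -/
noncomputable def nuT (n : ℕ) (S : Finset (PTree × PTree)) : ℝ :=
  tangleProb n fun t => (normalize t.1, normalize t.2.1) ∈ S

/-- The distribution on pairs of binary trees induced by two independent uniformly
random plane binary trees with `n` leaves. -/
noncomputable def nuP (n : ℕ) (S : Finset (PTree × PTree)) : ℝ :=
  (((planeTrees n) ×ˢ (planeTrees n)).filter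
      fun p => (normalize p.1, normalize p.2) ∈ S).card / ((planeTrees n).card ^ 2 : ℝ)

/-- The total variation distance between `nuT` and `nuP`. -/
noncomputable def tvDist (n : ℕ) : ℝ :=
  ((binTrees n ×ˢ binTrees n).powerset).sup' (Finset.powerset_nonempty _)
    fun S => |nuT n S - nuP n S|

/-- The number of occurrences of (trees isomorphic to) `B` as a fringe subtree of `T`. -/
def occ (B : PTree) : PTree → ℕ
  | leaf => if normalize leaf = normalize B then 1 else 0
  | node l r => (if normalize (node l r) = normalize B then 1 else 0) + occ B l + occ B r

/-- The number of generators of the automorphism group of `T`: the number of internal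
vertices whose two branches are isomorphic. -/
def gens : PTree → ℕ
  | leaf => 0
  | node l r => (if normalize l = normalize r then 1 else 0) + gens l + gens r

/-- `T` has a root branch isomorphic to `B`. -/
def hasBranch (B : PTree) : PTree → Prop
  | leaf => False
  | node l r => normalize l = normalize B ∨ normalize r = normalize B

/-- The cherries of a plane binary tree whose leaves are numbered from `k` on
(left to right), as pairs of leaf positions. -/
def cherryList : PTree → ℕ → List (ℕ × ℕ)
  | leaf, _ => []
  | node leaf leaf, k => [(k, k + 1)]
  | node l r, k => cherryList l k ++ cherryList r (k + l.size)

/-- The number of matched cherries: cherries of `T` whose two leaves are matched by `L`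
to the two leaves of a cherry of `S`. -/
def matchedCherries (T S : PTree) (L : List ℕ) : ℕ :=
  (cherryList T 0).countP fun p =>
    (cherryList S 0).any fun q =>
      (L.getD p.1 0 == q.1 && L.getD p.2 0 == q.2) ||
      (L.getD p.1 0 == q.2 && L.getD p.2 0 == q.1)

/-- The number of automorphisms of the tanglegram represented by the triple `(T, L, S)`:
pairs of automorphisms of the two trees compatible with the matching `L`. -/
def tangleAutCount (T S : PTree) (L : List ℕ) : ℕ :=
  ((isoFuns T T).map fun a =>
    (isoFuns S S).countP fun b =>
      (List.range T.size).all fun i => L.getD (a i) 0 == b (L.getD i 0)).sum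

/-- The number of automorphisms of `T` whose cycle type is `μ(s) = 2^s 1^(n-2s)`,
i.e. involutions of the leaves moving exactly `2 s` leaves. -/
def autMuCount (T : PTree) (s : ℕ) : ℕ :=
  (isoFuns T T).countP fun f =>
    ((List.range T.size).all fun i => f (f i) == i) &&
    ((List.range T.size).countP fun i => !(f i == i)) == 2 * s

end PTree

open PowerSeries in
/-- The span of the formal solutions of `(1 - 4X) y' = 2 j y`, that is of the multiples of
`(1 - 4X) ^ (-j/2)`, for integers `j ≤ d`. -/
noncomputable def growthSpace (d : ℤ) : Submodule ℝ ℝ⟦X⟧ :=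
  Submodule.span ℝ {y | ∃ j : ℤ, j ≤ d ∧ (1 - 4 * X) * derivative ℝ y = (2 * j : ℝ) • y}

namespace growthSpace

open PowerSeries Filter Topology

theorem mono {d e : ℤ} (h : d ≤ e) : growthSpace d ≤ growthSpace e := by
  apply Submodule.span_mono
  rintro y ⟨j, hj, hy⟩
  exact ⟨j, hj.trans h, hy⟩

theorem of_ode {d : ℤ} {y : ℝ⟦X⟧} (h : (1 - 4 * X) * derivative ℝ y = (2 * d : ℝ) • y) :
    y ∈ growthSpace d :=
  Submodule.subset_span ⟨d, le_rfl, h⟩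

theorem ode_mul {a b : ℝ} {y z : ℝ⟦X⟧} (hy : (1 - 4 * X) * derivative ℝ y = (2 * a) • y)
    (hz : (1 - 4 * X) * derivative ℝ z = (2 * b) • z) :
    (1 - 4 * X) * derivative ℝ (y * z) = (2 * (a + b)) • (y * z) := by
  rw [Derivation.leibniz, smul_eq_mul, smul_eq_mul]
  have : (1 - 4 * X) * (y * derivative ℝ z + z * derivative ℝ y) =
      y * ((1 - 4 * X) * derivative ℝ z) + z * ((1 - 4 * X) * derivative ℝ y) := by ring
  rw [this, hy, hz]
  simp only [smul_eq_C_mul, map_mul, map_add]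
  ring

theorem mul_mem {d e : ℤ} {y z : ℝ⟦X⟧} (hy : y ∈ growthSpace d) (hz : z ∈ growthSpace e) :
    y * z ∈ growthSpace (d + e) := by
  have h := Submodule.mul_mem_mul hy hz
  rw [growthSpace, growthSpace, Submodule.span_mul_span] at h
  refine Submodule.span_mono ?_ h
  rintro _ ⟨y, ⟨i, hi, hy⟩, z, ⟨j, hj, hz⟩, rfl⟩
  refine ⟨i + j, by omega, ?_⟩
  rw [ode_mul hy hz]
  push_cast
  rfl

theorem coeff_succ_of_ode {a : ℝ} {y : ℝ⟦X⟧}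
    (h : (1 - 4 * X) * derivative ℝ y = (2 * a) • y) (n : ℕ) :
    coeff (n + 1) y = (4 * n + 2 * a) / (n + 1) * coeff n y := by
  have hn := congrArg (coeff n) h
  have e : (1 - 4 * X) * derivative ℝ y
      = derivative ℝ y - C (4 : ℝ) * (X * derivative ℝ y) := by
    rw [show C (4 : ℝ) = 4 from map_ofNat C 4]; ring
  rw [e, map_sub, coeff_C_mul, coeff_smul, coeff_derivative, smul_eq_mul] at hn
  have hX : coeff n (X * derivative ℝ y) = n * coeff n y := by
    cases n with
    | zero => simp
    | succ m => rw [coeff_succ_X_mul, coeff_derivative]; push_cast; ring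
  rw [hX] at hn
  have : (n + 1 : ℝ) ≠ 0 := by positivity
  field_simp
  linear_combination hn

theorem tendsto_ratio_zero_of_ode {j d : ℤ} (hd : 1 ≤ d) (hjd : j < d) {y u : ℝ⟦X⟧}
    (hy : (1 - 4 * X) * derivative ℝ y = (2 * j : ℝ) • y)
    (hu : (1 - 4 * X) * derivative ℝ u = (2 * d : ℝ) • u) (hpos : ∀ n, 0 < coeff n u) :
    Tendsto (fun n => coeff n y / coeff n u) atTop (𝓝 0) := by
  set q : ℕ → ℝ := fun n => coeff n y / coeff n u with hq
  have hd' : (1 : ℝ) ≤ d := by exact_mod_cast hd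
  have hjd' : (j : ℝ) + 1 ≤ d := by exact_mod_cast hjd
  have hrec : ∀ n, q (n + 1) = q n * ((2 * n + j) / (2 * n + d)) := by
    intro n
    have h1 := (hpos n).ne'
    have h2 : (n + 1 : ℝ) ≠ 0 := by positivity
    have h3 : (2 * n + d : ℝ) ≠ 0 := by positivity
    simp only [hq]
    rw [coeff_succ_of_ode hy, coeff_succ_of_ode hu]
    have h4 : (4 * n + 2 * d : ℝ) ≠ 0 := by positivity
    field_simp
    ring
  obtain ⟨N, hN⟩ := exists_nat_ge (-(j : ℝ))
  have hstep : ∀ n, N ≤ n →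
      q (n + 1) ^ 2 * (2 * (n + 1 : ℕ) + d - 1) ≤ q n ^ 2 * (2 * n + d - 1) := by
    intro n hn
    have hn' : (N : ℝ) ≤ n := by exact_mod_cast hn
    have hn0 : (0 : ℝ) ≤ n := by positivity
    have h3 : (0 : ℝ) < 2 * n + d := by linarith
    rw [hrec, mul_pow, mul_assoc]
    apply mul_le_mul_of_nonneg_left _ (sq_nonneg _)
    rw [div_pow, div_mul_eq_mul_div, div_le_iff₀ (by positivity)]
    push_cast
    have h5 : (0 : ℝ) ≤ 2 * n + j := by linarith
    have h6 : (2 * n + j : ℝ) ^ 2 ≤ (2 * n + d - 1) ^ 2 := by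
      apply pow_le_pow_left₀ h5; linarith
    have h7 : (0 : ℝ) ≤ 2 * n + d - 1 := by linarith
    calc ((2 * n + j : ℝ)) ^ 2 * (2 * (n + 1) + (d : ℝ) - 1)
        ≤ (2 * n + d - 1 : ℝ) ^ 2 * (2 * (n + 1) + (d : ℝ) - 1) := by
          apply mul_le_mul_of_nonneg_right h6; linarith
      _ = (2 * n + d - 1 : ℝ) * ((2 * n + d : ℝ) ^ 2 - 1) := by ring
      _ ≤ _ := by apply mul_le_mul_of_nonneg_left _ h7; linarith
  set M := q N ^ 2 * (2 * N + d - 1)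
  have hbound : ∀ n, N ≤ n → q n ^ 2 * (2 * n + d - 1) ≤ M := by
    intro n hn
    induction n, hn using Nat.le_induction with
    | base => exact le_rfl
    | succ n hn ih => exact (hstep n hn).trans ih
  have hsq : Tendsto (fun n => q n ^ 2) atTop (𝓝 0) := by
    have hlim : Tendsto (fun n : ℕ => M / n) atTop (𝓝 0) :=
      tendsto_const_div_atTop_nhds_zero_nat M
    refine tendsto_of_tendsto_of_tendsto_of_le_of_le' tendsto_const_nhds hlim
      (Eventually.of_forall fun n => sq_nonneg _) ?_
    filter_upwards [eventually_ge_atTop (max N 1)] with n hn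
    have h1 : N ≤ n := le_trans (le_max_left _ _) hn
    have h2 : (1 : ℝ) ≤ n := by exact_mod_cast le_trans (le_max_right _ _) hn
    rw [le_div_iff₀ (by linarith)]
    refine le_trans ?_ (hbound n h1)
    apply mul_le_mul_of_nonneg_left _ (sq_nonneg _)
    linarith
  rw [tendsto_zero_iff_abs_tendsto_zero]
  have := hsq.sqrt
  simpa [Function.comp_def, Real.sqrt_sq_eq_abs] using this

theorem tendsto_ratio_zero {d : ℤ} (hd : 1 ≤ d) {y u : ℝ⟦X⟧} (hy : y ∈ growthSpace (d - 1))
    (hu : (1 - 4 * X) * derivative ℝ u = (2 * d : ℝ) • u) (hpos : ∀ n, 0 < coeff n u) :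
    Tendsto (fun n => coeff n y / coeff n u) atTop (𝓝 0) := by
  refine Submodule.span_induction (p := fun y _ =>
    Tendsto (fun n => coeff n y / coeff n u) atTop (𝓝 0)) ?_ ?_ ?_ ?_ hy
  · rintro y ⟨j, hj, hy⟩
    exact tendsto_ratio_zero_of_ode hd (by omega) hy hu hpos
  · simp
  · intro y z _ _ h1 h2
    simpa [add_div] using h1.add h2
  · intro a y _ h
    simpa [mul_div_assoc] using h.const_mul a

theorem tendsto_succ_ratio_of_ode {a : ℝ} {y : ℝ⟦X⟧}
    (hy : (1 - 4 * X) * derivative ℝ y = (2 * a) • y) (h0 : ∀ᶠ n in atTop, coeff n y ≠ 0) :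
    Tendsto (fun n => coeff n y / coeff (n + 1) y) atTop (𝓝 (1 / 4)) := by
  have h : Tendsto (fun n : ℕ => (n + 1 : ℝ) / (2 * a + 4 * n)) atTop (𝓝 (1 / 4)) := by
    have := tendsto_add_mul_div_add_mul_atTop_nhds (1 : ℝ) (2 * a) 1 (d := 4) (by norm_num)
    simpa [add_comm] using this
  refine h.congr' ?_
  filter_upwards [h0] with n hn
  rw [coeff_succ_of_ode hy, div_mul_eq_mul_div, div_div_eq_mul_div]
  rw [mul_comm (4 * (n : ℝ) + 2 * a), ← div_div, mul_div_cancel_left₀ _ hn, add_comm (4 * (n : ℝ))]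

end growthSpace

/-- Data for the asymptotic analysis of a generating function `C = X + C ^ 2`
with vanishing constant term. -/
structure CatalanRoot (c : PowerSeries ℝ) : Prop where
  eq_X_add_mul : c = PowerSeries.X + c * c
  const : PowerSeries.constantCoeff c = 0

namespace CatalanRoot

open PowerSeries Filter Topology

/-- The square root `1 - 2 c` of `1 - 4X`. -/
noncomputable def root (c : ℝ⟦X⟧) : ℝ⟦X⟧ := 1 - 2 * c

variable {c : ℝ⟦X⟧}

theorem C_two : (C (2 : ℝ) : ℝ⟦X⟧) = 2 := map_ofNat C 2

theorem root_mul_root (hc : CatalanRoot c) : root c * root c = 1 - 4 * X := by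
  unfold root
  linear_combination (-4 : ℝ⟦X⟧) * hc.eq_X_add_mul

theorem constantCoeff_root (hc : CatalanRoot c) : constantCoeff (root c) = 1 := by
  simp [root, hc.const]

theorem root_mul_inv (hc : CatalanRoot c) : root c * (root c)⁻¹ = 1 :=
  PowerSeries.mul_inv_cancel _ (by simp [hc.constantCoeff_root])

theorem root_ode (hc : CatalanRoot c) :
    (1 - 4 * X) * derivative ℝ (root c) = (2 * (-1 : ℤ) : ℝ) • root c := by
  have h := congrArg (derivative ℝ) hc.root_mul_root
  have h4 : derivative ℝ (4 : ℝ⟦X⟧) = 0 := by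
    rw [show (4 : ℝ⟦X⟧) = C (4 : ℝ) from (map_ofNat C 4).symm]; exact derivative_C
  rw [Derivation.leibniz, map_sub, Derivation.leibniz, derivative_one, derivative_X, h4] at h
  simp only [smul_eq_mul, mul_one, mul_zero, add_zero, zero_sub] at h
  have h2 : (2 : ℝ⟦X⟧) * (root c * derivative ℝ (root c) + 2) = 0 := by linear_combination h
  have h3 : root c * derivative ℝ (root c) + 2 = 0 := by
    have h5 : (C (1 / 2 : ℝ) : ℝ⟦X⟧) * 2 = 1 := by rw [← C_two, ← map_mul]; norm_num
    linear_combination C (1 / 2 : ℝ) * h2 - (root c * derivative ℝ (root c) + 2) * h5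
  rw [← hc.root_mul_root, smul_eq_C_mul]
  have : (C (2 * ((-1 : ℤ) : ℝ)) : ℝ⟦X⟧) = -2 := by
    simp [C_two]
  rw [this]
  linear_combination root c * h3

theorem inv_ode (hc : CatalanRoot c) :
    (1 - 4 * X) * derivative ℝ (root c)⁻¹ = (2 * (1 : ℤ) : ℝ) • (root c)⁻¹ := by
  have h := hc.root_ode
  have h1 := hc.root_mul_inv
  have h2 : derivative ℝ (root c)⁻¹ = -(root c)⁻¹ ^ 2 * derivative ℝ (root c) :=
    derivative_inv' _
  rw [h2]
  rw [smul_eq_C_mul] at h ⊢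
  have e1 : (C (2 * ((-1 : ℤ) : ℝ)) : ℝ⟦X⟧) = -2 := by simp [C_two]
  have e2 : (C (2 * ((1 : ℤ) : ℝ)) : ℝ⟦X⟧) = 2 := by simp [C_two]
  rw [e1] at h
  rw [e2]
  linear_combination (-(root c)⁻¹ ^ 2) * h + 2 * (root c)⁻¹ * h1

theorem inv_pow_ode (hc : CatalanRoot c) (d : ℕ) :
    (1 - 4 * X) * derivative ℝ ((root c)⁻¹ ^ d) = (2 * (d : ℤ) : ℝ) • (root c)⁻¹ ^ d := by
  induction d with
  | zero => simp
  | succ d ih =>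
    rw [pow_succ, growthSpace.ode_mul ih hc.inv_ode]
    push_cast
    rfl

theorem coeff_inv_pow_pos (hc : CatalanRoot c) {d : ℕ} (hd : 1 ≤ d) (n : ℕ) :
    0 < coeff n ((root c)⁻¹ ^ d) := by
  induction n with
  | zero => simp [hc.constantCoeff_root]
  | succ n ih =>
    rw [growthSpace.coeff_succ_of_ode (hc.inv_pow_ode d)]
    have : (1 : ℝ) ≤ d := by exact_mod_cast hd
    have : (0 : ℝ) < 4 * n + 2 * (d : ℤ) := by push_cast; positivity
    positivity

/-- `F` is `A (1 - 4X) ^ (-d/2)` up to terms of smaller growth. -/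
def HasLead (c : ℝ⟦X⟧) (d : ℕ) (A : ℝ) (F : ℝ⟦X⟧) : Prop :=
  F - A • (root c)⁻¹ ^ d ∈ growthSpace (d - 1)

theorem inv_pow_mem (hc : CatalanRoot c) (d : ℕ) : (root c)⁻¹ ^ d ∈ growthSpace d :=
  growthSpace.of_ode (hc.inv_pow_ode d)

theorem HasLead.mem (hc : CatalanRoot c) {d : ℕ} {A : ℝ} {F : ℝ⟦X⟧} (h : HasLead c d A F) :
    F ∈ growthSpace d := by
  have := Submodule.add_mem _ (growthSpace.mono (by omega) h)
    (Submodule.smul_mem _ A (hc.inv_pow_mem d))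
  simpa using this

theorem HasLead.mul (hc : CatalanRoot c) {d e : ℕ} {A B : ℝ} {F G : ℝ⟦X⟧}
    (hF : HasLead c d A F) (hG : HasLead c e B G) : HasLead c (d + e) (A * B) (F * G) := by
  have h1 := growthSpace.mul_mem hF (hG.mem hc)
  have h2 := growthSpace.mul_mem (Submodule.smul_mem _ A (hc.inv_pow_mem d)) hG
  have h := Submodule.add_mem _ (growthSpace.mono (e := ((d + e : ℕ) : ℤ) - 1) (by push_cast; omega) h1)
    (growthSpace.mono (e := ((d + e : ℕ) : ℤ) - 1) (by push_cast; omega) h2)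
  unfold HasLead
  convert h using 1
  simp only [smul_eq_C_mul, map_mul, pow_add]
  ring

theorem HasLead.add (hc : CatalanRoot c) {d e : ℕ} {A B : ℝ} {F G : ℝ⟦X⟧} (hA : 0 < A)
    (hB : 0 < B) (hF : HasLead c d A F) (hG : HasLead c e B G) :
    ∃ a : ℝ, 0 < a ∧ HasLead c (max d e) a (F + G) := by
  have key : ∀ {d e : ℕ} {A B : ℝ} {F G : ℝ⟦X⟧}, d < e → HasLead c d A F → HasLead c e B G →
      HasLead c e B (F + G) := by
    intro d e A B F G hde hF hG
    have := Submodule.add_mem _ (growthSpace.mono (e := (e : ℤ) - 1) (by omega) (hF.mem hc)) hG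
    unfold HasLead
    convert this using 1
    ring
  rcases lt_trichotomy d e with h | rfl | h
  · exact ⟨B, hB, by rw [max_eq_right h.le]; exact key h hF hG⟩
  · refine ⟨A + B, by positivity, ?_⟩
    have := Submodule.add_mem _ hF hG
    rw [max_self]
    unfold HasLead
    convert this using 1
    rw [add_smul]
    ring
  · exact ⟨A, hA, by rw [max_eq_left h.le, add_comm]; exact key h hG hF⟩

theorem HasLead.tendsto (hc : CatalanRoot c) {d : ℕ} (hd : 1 ≤ d) {A : ℝ} {F : ℝ⟦X⟧}
    (h : HasLead c d A F) :
    Tendsto (fun n => coeff n F / coeff n ((root c)⁻¹ ^ d)) atTop (𝓝 A) := by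
  have h1 := growthSpace.tendsto_ratio_zero (by exact_mod_cast hd) h (hc.inv_pow_ode d)
    (hc.coeff_inv_pow_pos hd)
  have h2 := h1.add_const A
  rw [zero_add] at h2
  refine h2.congr fun n => ?_
  have := (hc.coeff_inv_pow_pos hd n).ne'
  rw [map_sub, coeff_smul, smul_eq_mul]
  field_simp
  ring

theorem HasLead.tendsto_ratio_zero (hc : CatalanRoot c) {d : ℕ} (hd : 1 ≤ d) {A : ℝ}
    (hA : A ≠ 0) {F G : ℝ⟦X⟧} (h : HasLead c d A F) (hG : G ∈ growthSpace (d - 1)) :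
    Tendsto (fun n => coeff n G / coeff n F) atTop (𝓝 0) := by
  have h1 := growthSpace.tendsto_ratio_zero (by exact_mod_cast hd) hG (hc.inv_pow_ode d)
    (hc.coeff_inv_pow_pos hd)
  have h2 := h1.div (h.tendsto hc hd) hA
  rw [zero_div] at h2
  refine h2.congr fun n => ?_
  exact div_div_div_cancel_right₀ (hc.coeff_inv_pow_pos hd n).ne' _ _

theorem HasLead.tendsto_succ (hc : CatalanRoot c) {d : ℕ} (hd : 1 ≤ d) {A : ℝ}
    (hA : A ≠ 0) {F : ℝ⟦X⟧} (h : HasLead c d A F) :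
    Tendsto (fun n => coeff n F / coeff (n + 1) F) atTop (𝓝 (1 / 4)) := by
  have h1 := h.tendsto hc hd
  have h2 := h1.comp (tendsto_add_atTop_nat 1)
  have h3 := growthSpace.tendsto_succ_ratio_of_ode (hc.inv_pow_ode d)
    (Eventually.of_forall fun n => (hc.coeff_inv_pow_pos hd n).ne')
  have h4 := (h1.div h2 hA).mul h3
  rw [div_self hA, one_mul] at h4
  refine h4.congr fun n => ?_
  have e1 := (hc.coeff_inv_pow_pos hd n).ne'
  have e2 := (hc.coeff_inv_pow_pos hd (n + 1)).ne'
  simp only [Pi.div_apply, Function.comp_apply]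
  by_cases h0 : coeff (n + 1) F = 0
  · simp [h0]
  · field_simp

theorem self_mem (hc : CatalanRoot c) : c ∈ growthSpace 0 := by
  have h1 : (1 : ℝ⟦X⟧) ∈ growthSpace 0 := by simpa using hc.inv_pow_mem 0
  have h2 : root c ∈ growthSpace 0 := growthSpace.mono (by norm_num) (growthSpace.of_ode hc.root_ode)
  have h3 := Submodule.smul_mem _ (1 / 2 : ℝ) (Submodule.sub_mem _ h1 h2)
  convert h3 using 1
  rw [root, smul_eq_C_mul]
  have : (C (1 / 2 : ℝ) : ℝ⟦X⟧) * 2 = 1 := by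
    rw [← C_two, ← map_mul]; norm_num
  linear_combination (-c) * this

theorem self_tendsto_succ (hc : CatalanRoot c) :
    Tendsto (fun n => coeff n c / coeff (n + 1) c) atTop (𝓝 (1 / 4)) := by
  have hcoeff : ∀ n, coeff (n + 1) c = (-1 / 2) * coeff (n + 1) (root c) := by
    intro n
    rw [root, map_sub, coeff_one, if_neg (by omega),
      ← C_two, coeff_C_mul]
    ring
  have hne : ∀ n, coeff n (root c) ≠ 0 := by
    intro n
    induction n with
    | zero => simp [hc.constantCoeff_root]
    | succ n ih =>
      rw [growthSpace.coeff_succ_of_ode hc.root_ode]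
      have h1 : (4 * n + 2 * ((-1 : ℤ) : ℝ)) ≠ 0 := by
        intro h
        have h' : ((4 * n + 2 * (-1) : ℤ) : ℝ) = 0 := by push_cast; exact_mod_cast h
        have : (4 * n + 2 * (-1) : ℤ) = 0 := by exact_mod_cast h'
        omega
      have h2 : (n + 1 : ℝ) ≠ 0 := by positivity
      exact mul_ne_zero (div_ne_zero h1 h2) ih
  have h := growthSpace.tendsto_succ_ratio_of_ode hc.root_ode (Eventually.of_forall hne)
  refine h.congr' ?_
  filter_upwards [eventually_ge_atTop 1] with n hn
  obtain ⟨m, rfl⟩ := Nat.exists_eq_add_of_le' hn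
  rw [hcoeff, hcoeff, mul_div_mul_left _ _ (by norm_num)]

theorem X_hasLead (hc : CatalanRoot c) : HasLead c 0 (1 / 4) X := by
  have h := growthSpace.ode_mul hc.root_ode hc.root_ode
  have h1 : root c * root c ∈ growthSpace (-2) := by
    apply growthSpace.of_ode
    convert h using 2
    norm_num
  have h2 := Submodule.smul_mem _ (-1 / 4 : ℝ) (growthSpace.mono (e := ((0 : ℕ) : ℤ) - 1) (by norm_num) h1)
  unfold HasLead
  convert h2 using 1
  rw [hc.root_mul_root, smul_eq_C_mul, smul_eq_C_mul, pow_zero]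
  have e1 : (4 : ℝ⟦X⟧) = C (4 : ℝ) := (map_ofNat C 4).symm
  have e2 : (C (-1 / 4 : ℝ) : ℝ⟦X⟧) = - C (1 / 4) := by rw [← map_neg]; norm_num
  have e3 : (C (1 / 4 : ℝ) : ℝ⟦X⟧) * C 4 = 1 := by rw [← map_mul]; norm_num
  rw [e2, e1]
  linear_combination (-X) * e3

theorem X_pow_hasLead (hc : CatalanRoot c) (n : ℕ) : HasLead c 0 ((1 / 4) ^ n) (X ^ n) := by
  induction n with
  | zero => simp [HasLead]
  | succ n ih => simpa [pow_succ] using ih.mul hc hc.X_hasLead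

theorem hasLead_sum (hc : CatalanRoot c) {ι : Type*} (s : Finset ι) (F : ι → ℝ⟦X⟧) {d : ℕ}
    (h : ∀ i ∈ s, F i = 0 ∨ ∃ e, d ≤ e ∧ ∃ A : ℝ, 0 < A ∧ HasLead c e A (F i)) :
    ∑ i ∈ s, F i = 0 ∨ ∃ e, d ≤ e ∧ ∃ A : ℝ, 0 < A ∧ HasLead c e A (∑ i ∈ s, F i) := by
  induction s using Finset.cons_induction with
  | empty => simp
  | cons i s hi ih =>
    rw [Finset.sum_cons]
    have h1 := h i (Finset.mem_cons_self _ _)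
    have h2 := ih fun j hj => h j (Finset.mem_cons_of_mem hj)
    rcases h1 with h1 | ⟨e, he, A, hA, h1⟩
    · rw [h1, zero_add]; exact h2
    · rcases h2 with h2 | ⟨e', he', B, hB, h2⟩
      · rw [h2, add_zero]; exact Or.inr ⟨e, he, A, hA, h1⟩
      · obtain ⟨a, ha, h3⟩ := h1.add hc hA hB h2
        exact Or.inr ⟨_, le_max_of_le_left he, a, ha, h3⟩

theorem hasLead_of_eventually_zero (hc : CatalanRoot c) {F : ℝ⟦X⟧} (h0 : ∀ n, 0 ≤ coeff n F)
    {N : ℕ} (hN : ∀ n, N ≤ n → coeff n F = 0) :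
    F = 0 ∨ ∃ A : ℝ, 0 < A ∧ HasLead c 0 A F := by
  have hF : F = ∑ n ∈ Finset.range N, coeff n F • (X ^ n : ℝ⟦X⟧) := by
    ext m
    simp only [map_sum, coeff_smul, coeff_X_pow, smul_eq_mul, mul_ite, mul_one, mul_zero]
    rw [Finset.sum_ite_eq]
    split_ifs with h
    · rfl
    · exact hN m (by simpa using h)
  have hlead : HasLead c 0 (∑ n ∈ Finset.range N, coeff n F * (1 / 4) ^ n) F := by
    unfold HasLead
    have : F - (∑ n ∈ Finset.range N, coeff n F * (1 / 4) ^ n) • (root c)⁻¹ ^ 0 =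
        ∑ n ∈ Finset.range N, coeff n F • (X ^ n - ((1 / 4 : ℝ) ^ n) • (root c)⁻¹ ^ 0) := by
      conv_lhs => rw [hF]
      simp only [Finset.sum_smul, smul_sub, Finset.sum_sub_distrib, mul_smul]
      congr 1
      apply Finset.sum_congr rfl
      intro x _
      rw [← hF]
    rw [this]
    exact Submodule.sum_mem _ fun n _ => Submodule.smul_mem _ _ (hc.X_pow_hasLead n)
  by_cases hz : ∃ n, coeff n F ≠ 0
  · obtain ⟨n, hn⟩ := hz
    refine Or.inr ⟨_, ?_, hlead⟩
    apply Finset.sum_pos'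
    · intro i _; have := h0 i; positivity
    · refine ⟨n, ?_, ?_⟩
      · rw [Finset.mem_range]; by_contra h; exact hn (hN n (by omega))
      · have := lt_of_le_of_ne (h0 n) hn.symm
        positivity
  · left
    ext n
    by_contra h
    exact hz ⟨n, by simpa using h⟩

end CatalanRoot

/-- Generating functions indexed by multisets, satisfying the quadratic recursion of binary
trees decorated with a multiset, up to finite corrections. -/
structure BranchSystem (F G : Multiset ℕ → PowerSeries ℝ) : Prop where
  nonneg : ∀ μ n, 0 ≤ PowerSeries.coeff n (F μ)
  corr_nonneg : ∀ μ n, 0 ≤ PowerSeries.coeff n (G μ)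
  corr_finite : ∀ μ, ∃ N, ∀ n, N ≤ n → PowerSeries.coeff n (G μ) = 0
  corr_zero : G 0 = 0
  const : ∀ μ, PowerSeries.constantCoeff (F μ) = 0
  rec_eq : ∀ μ, F μ = (if μ = 0 then PowerSeries.X else 0) +
    ∑ ν ∈ Finset.Iic μ, F ν * F (μ - ν) + G μ

namespace BranchSystem

open PowerSeries Filter Topology CatalanRoot

variable {F G : Multiset ℕ → ℝ⟦X⟧}

theorem catalanRoot (h : BranchSystem F G) : CatalanRoot (F 0) where
  eq_X_add_mul := by
    have h0 := h.rec_eq 0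
    have : Finset.Iic (0 : Multiset ℕ) = {0} := by ext; simp
    rw [this] at h0
    simpa [h.corr_zero] using h0
  const := h.const 0

theorem eq_mul_inv (h : BranchSystem F G) {μ : Multiset ℕ} (hμ : μ ≠ 0) :
    F μ = (∑ ν ∈ ((Finset.Iic μ).erase 0).erase μ, F ν * F (μ - ν) + G μ) *
      (root (F 0))⁻¹ ^ 1 := by
  have h1 := h.rec_eq μ
  rw [if_neg hμ, zero_add] at h1
  rw [← Finset.add_sum_erase _ _ (show (0 : Multiset ℕ) ∈ Finset.Iic μ by simp),
    ← Finset.add_sum_erase _ _ (show μ ∈ (Finset.Iic μ).erase 0 by simp [hμ])] at h1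
  rw [tsub_zero, tsub_self] at h1
  set E := ∑ ν ∈ ((Finset.Iic μ).erase 0).erase μ, F ν * F (μ - ν)
  have h2 : E + G μ = F μ * root (F 0) := by
    unfold root
    linear_combination -h1
  rw [h2, pow_one, mul_assoc, h.catalanRoot.root_mul_inv, mul_one]

theorem hasLead (h : BranchSystem F G) {μ : Multiset ℕ} (hμ : μ ≠ 0) :
    F μ = 0 ∨ ∃ e, 1 ≤ e ∧ ∃ A : ℝ, 0 < A ∧ HasLead (F 0) e A (F μ) := by
  induction μ using Multiset.strongInductionOn with
  | ih μ ih =>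
    have hc := h.catalanRoot
    have hE : ∀ ν ∈ ((Finset.Iic μ).erase 0).erase μ, F ν * F (μ - ν) = 0 ∨
        ∃ e, 0 ≤ e ∧ ∃ A : ℝ, 0 < A ∧ HasLead (F 0) e A (F ν * F (μ - ν)) := by
      intro ν hν
      simp only [Finset.mem_erase, Finset.mem_Iic] at hν
      obtain ⟨h1, h2, h3⟩ := hν
      have h4 : μ - ν < μ := by
        refine lt_of_le_of_ne tsub_le_self fun he => h2 ?_
        have h5 := tsub_add_cancel_of_le h3
        rw [he] at h5
        simpa using h5
      have h6 : μ - ν ≠ 0 := by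
        intro he
        exact h1 (le_antisymm h3 (tsub_eq_zero_iff_le.mp he))
      rcases ih ν (lt_of_le_of_ne h3 h1) h2 with h7 | ⟨e, he, A, hA, h7⟩
      · left; rw [h7, zero_mul]
      · rcases ih _ h4 h6 with h8 | ⟨e', he', B, hB, h8⟩
        · left; rw [h8, mul_zero]
        · exact Or.inr ⟨e + e', by omega, A * B, by positivity, h7.mul hc h8⟩
    have hinv : HasLead (F 0) 1 1 ((root (F 0))⁻¹ ^ 1) := by simp [HasLead]
    rw [h.eq_mul_inv hμ]
    obtain ⟨N, hN⟩ := h.corr_finite μ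
    have hG := hc.hasLead_of_eventually_zero (h.corr_nonneg μ) hN
    have hsum := hc.hasLead_sum _ _ hE
    have htot : (∑ ν ∈ ((Finset.Iic μ).erase 0).erase μ, F ν * F (μ - ν) + G μ = 0) ∨
        ∃ e, ∃ A : ℝ, 0 < A ∧ HasLead (F 0) e A
          (∑ ν ∈ ((Finset.Iic μ).erase 0).erase μ, F ν * F (μ - ν) + G μ) := by
      rcases hsum with h1 | ⟨e, _, A, hA, h1⟩
      · rw [h1, zero_add]
        rcases hG with h2 | ⟨A, hA, h2⟩
        · exact Or.inl h2
        · exact Or.inr ⟨0, A, hA, h2⟩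
      · rcases hG with h2 | ⟨B, hB, h2⟩
        · rw [h2, add_zero]; exact Or.inr ⟨e, A, hA, h1⟩
        · obtain ⟨a, ha, h3⟩ := h1.add hc hA hB h2
          exact Or.inr ⟨_, a, ha, h3⟩
    rcases htot with h1 | ⟨e, A, hA, h1⟩
    · left; rw [h1, zero_mul]
    · exact Or.inr ⟨e + 1, by omega, A * 1, by simpa using hA, h1.mul hc hinv⟩

theorem tendsto_succ (h : BranchSystem F G) {μ : Multiset ℕ} (hμ : F μ ≠ 0) :
    Tendsto (fun n => coeff n (F μ) / coeff (n + 1) (F μ)) atTop (𝓝 (1 / 4)) := by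
  by_cases h0 : μ = 0
  · rw [h0]; exact h.catalanRoot.self_tendsto_succ
  · rcases h.hasLead h0 with h1 | ⟨e, he, A, hA, h1⟩
    · exact absurd h1 hμ
    · exact h1.tendsto_succ h.catalanRoot he hA.ne'

theorem eventually_pos (h : BranchSystem F G) {μ : Multiset ℕ} (hμ : F μ ≠ 0) :
    ∀ᶠ n in atTop, 0 < coeff n (F μ) := by
  filter_upwards [(h.tendsto_succ hμ).eventually_ne (show (1 / 4 : ℝ) ≠ 0 by norm_num)] with n hn
  exact lt_of_le_of_ne (h.nonneg μ n) fun h0 => hn (by rw [← h0, zero_div])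

theorem tendsto_shift (h : BranchSystem F G) {μ : Multiset ℕ} (hμ : F μ ≠ 0) (b : ℕ) :
    Tendsto (fun n => coeff (n - b) (F μ) / coeff n (F μ)) atTop (𝓝 ((1 / 4) ^ b)) := by
  induction b with
  | zero =>
    refine (tendsto_const_nhds (x := ((1 / 4 : ℝ) ^ 0))).congr' ?_
    filter_upwards [h.eventually_pos hμ] with n hn
    rw [Nat.sub_zero, div_self hn.ne', pow_zero]
  | succ b ih =>
    have h1 := (h.tendsto_succ hμ).comp (tendsto_sub_atTop_nat (b + 1))
    have h2 := h1.mul ih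
    rw [pow_succ']
    refine h2.congr' ?_
    filter_upwards [eventually_ge_atTop (b + 1), (tendsto_sub_atTop_nat b).eventually
      (h.eventually_pos hμ)] with n hn hp
    simp only [Function.comp_apply]
    rw [show n - (b + 1) + 1 = n - b by omega]
    field_simp

theorem coeff_mul_le (h : BranchSystem F G) {μ ν : Multiset ℕ} (hν : ν ≤ μ) (n : ℕ) :
    coeff n (F ν * F (μ - ν)) ≤ coeff n (F μ) := by
  have hmul : ∀ a b : Multiset ℕ, 0 ≤ coeff n (F a * F b) := fun a b => by
    rw [coeff_mul]
    exact Finset.sum_nonneg fun i _ => mul_nonneg (h.nonneg _ _) (h.nonneg _ _)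
  rw [h.rec_eq μ, map_add, map_add, map_sum]
  have h1 := Finset.single_le_sum (f := fun ν => coeff n (F ν * F (μ - ν)))
    (fun i _ => hmul _ _) (Finset.mem_Iic.mpr hν)
  have h2 : 0 ≤ coeff n (if μ = 0 then (X : ℝ⟦X⟧) else 0) := by
    split_ifs
    · rw [coeff_X]; split_ifs <;> norm_num
    · simp
  linarith [h.corr_nonneg μ n]

theorem tendsto_sub_zero (h : BranchSystem F G) {μ ν : Multiset ℕ} (hν : ν ≤ μ) (h0 : ν ≠ 0)
    (hF : F ν ≠ 0) :
    Tendsto (fun n => coeff n (F (μ - ν)) / coeff n (F μ)) atTop (𝓝 0) := by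
  by_cases hs : F (μ - ν) = 0
  · simp [hs]
  have hc := h.catalanRoot
  rcases h.hasLead h0 with h1 | ⟨e, he, A, hA, h1⟩
  · exact absurd h1 hF
  by_cases hμν : μ - ν = 0
  · have : ν = μ := le_antisymm hν (tsub_eq_zero_iff_le.mp hμν)
    rw [hμν, ← this]
    exact h1.tendsto_ratio_zero hc he hA.ne' (growthSpace.mono (by omega) hc.self_mem)
  rcases h.hasLead hμν with h2 | ⟨d, hd, B, hB, h2⟩
  · exact absurd h2 hs
  have h3 := h1.mul hc h2
  have h4 := h3.tendsto_ratio_zero hc (by omega) (by positivity)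
    (growthSpace.mono (e := ((e + d : ℕ) : ℤ) - 1) (by push_cast; omega) (h2.mem hc))
  have h5 := (h3.tendsto hc (by omega)).eventually (lt_mem_nhds (show 0 < A * B by positivity))
  refine tendsto_of_tendsto_of_tendsto_of_le_of_le' tendsto_const_nhds h4
    (Eventually.of_forall fun n => div_nonneg (h.nonneg _ _) (h.nonneg _ _)) ?_
  filter_upwards [h5] with n hn
  have h6 : 0 < coeff n (F ν * F (μ - ν)) :=
    (div_pos_iff_of_pos_right (hc.coeff_inv_pow_pos (by omega) n)).mp hn
  exact div_le_div_of_nonneg_left (h.nonneg _ _) h6 (h.coeff_mul_le hν n)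

theorem tendsto_branch (h : BranchSystem F G) {μ : Multiset ℕ} (hμ : F μ ≠ 0)
    (q : Multiset ℕ → ℝ) (hq : ∀ ν, q ν ≠ 0 → F ν ≠ 0) (b : ℕ) :
    Tendsto (fun n => (∑ ν ∈ Finset.Iic μ, q ν * coeff (n - b) (F (μ - ν))) / coeff n (F μ))
      atTop (𝓝 (q 0 * (1 / 4) ^ b)) := by
  have hterm : ∀ ν ∈ Finset.Iic μ,
      Tendsto (fun n => q ν * coeff (n - b) (F (μ - ν)) / coeff n (F μ)) atTop
        (𝓝 (if ν = 0 then q 0 * (1 / 4) ^ b else 0)) := by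
    intro ν hν
    split_ifs with h0
    · subst h0
      simpa [mul_div_assoc] using (h.tendsto_shift hμ b).const_mul (q 0)
    · by_cases hqν : q ν = 0
      · simp [hqν]
      by_cases hs : F (μ - ν) = 0
      · simp [hs]
      have h1 := ((h.tendsto_shift hs b).mul
        (h.tendsto_sub_zero (Finset.mem_Iic.mp hν) h0 (hq ν hqν))).const_mul (q ν)
      rw [mul_zero, mul_zero] at h1
      refine h1.congr' ?_
      filter_upwards [h.eventually_pos hs, h.eventually_pos hμ] with n h2 h3
      field_simp
  have h1 := tendsto_finsetSum _ hterm
  rw [Finset.sum_ite_eq' , if_pos (by simp)] at h1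
  refine h1.congr fun n => ?_
  rw [Finset.sum_div]

end BranchSystem

namespace PTree

/-- The leaves of a plane binary tree. -/
def Leaves : PTree → Type
  | leaf => Unit
  | node l r => Leaves l ⊕ Leaves r

noncomputable instance Leaves.instFintype : ∀ T : PTree, Fintype (Leaves T)
  | leaf => inferInstanceAs (Fintype Unit)
  | node l r =>
    letI := Leaves.instFintype l
    letI := Leaves.instFintype r
    inferInstanceAs (Fintype (Leaves l ⊕ Leaves r))

theorem card_leaves (T : PTree) : Fintype.card (Leaves T) = T.size := by
  induction T with
  | leaf => exact Fintype.card_unit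
  | node l r hl hr =>
    rw [size, ← hl, ← hr]
    exact Fintype.card_sum

theorem size_pos (T : PTree) : 0 < T.size := by
  induction T with
  | leaf => exact Nat.one_pos
  | node l r hl hr => rw [size]; omega

/-- The position of a leaf, from left to right. -/
def pos : (T : PTree) → Leaves T → ℕ
  | leaf, _ => 0
  | node l _, .inl x => pos l x
  | node l r, .inr x => pos r x + l.size

theorem pos_lt : ∀ (T : PTree) (x : Leaves T), pos T x < T.size
  | leaf, _ => Nat.one_pos
  | node l r, .inl x => by have := pos_lt l x; rw [pos, size]; omega
  | node l r, .inr x => by have := pos_lt r x; rw [pos, size]; omega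

theorem pos_injective (T : PTree) : Function.Injective (pos T) := by
  induction T with
  | leaf => intro x y _; cases x; cases y; rfl
  | node l r hl hr =>
    rintro (x | x) (y | y) h <;> simp only [pos] at h
    · rw [hl h]
    · have := pos_lt l x; omega
    · have := pos_lt l y; omega
    · rw [hr (Nat.add_right_cancel h)]

theorem exists_pos (T : PTree) {i : ℕ} (hi : i < T.size) : ∃ x, pos T x = i := by
  induction T generalizing i with
  | leaf =>
    rw [size] at hi
    exact ⟨(), (Nat.lt_one_iff.mp hi).symm⟩
  | node l r hl hr =>
    rw [size] at hi
    by_cases h : i < l.size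
    · obtain ⟨x, hx⟩ := hl h
      exact ⟨.inl x, hx⟩
    · obtain ⟨x, hx⟩ := hr (i := i - l.size) (by omega)
      exact ⟨.inr x, by rw [pos, hx]; omega⟩

/-- The isomorphism of two nodes that keeps the order of the branches. -/
def straight {l r l' r' : PTree} (g : Leaves l ≃ Leaves l') (h : Leaves r ≃ Leaves r') :
    Leaves (node l r) ≃ Leaves (node l' r') :=
  Equiv.sumCongr g h

/-- The isomorphism of two nodes that exchanges the branches. -/
def crossed {l r l' r' : PTree} (g : Leaves l ≃ Leaves r') (h : Leaves r ≃ Leaves l') :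
    Leaves (node l r) ≃ Leaves (node l' r') :=
  (Equiv.sumCongr g h).trans (Equiv.sumComm _ _)

/-- The isomorphisms between two binary trees, as bijections of their leaves. -/
noncomputable def isos : (T T' : PTree) → Finset (Leaves T ≃ Leaves T')
  | leaf, leaf => {Equiv.refl _}
  | node l r, node l' r' =>
      (isos l l' ×ˢ isos r r').image (fun p => straight p.1 p.2) ∪
      (isos l r' ×ˢ isos r l').image (fun p => crossed p.1 p.2)
  | leaf, node _ _ => ∅
  | node _ _, leaf => ∅

theorem mem_isos_node {l r l' r' : PTree} {e : Leaves (node l r) ≃ Leaves (node l' r')} :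
    e ∈ isos (node l r) (node l' r') ↔
      (∃ g ∈ isos l l', ∃ h ∈ isos r r', straight g h = e) ∨
      (∃ g ∈ isos l r', ∃ h ∈ isos r l', crossed g h = e) := by
  simp only [isos, Finset.mem_union, Finset.mem_image, Finset.mem_product, Prod.exists, and_assoc]
  constructor
  · rintro (⟨g, h, hg, hh, rfl⟩ | ⟨g, h, hg, hh, rfl⟩)
    · exact Or.inl ⟨g, hg, h, hh, rfl⟩
    · exact Or.inr ⟨g, hg, h, hh, rfl⟩
  · rintro (⟨g, hg, h, hh, rfl⟩ | ⟨g, hg, h, hh, rfl⟩)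
    · exact Or.inl ⟨g, h, hg, hh, rfl⟩
    · exact Or.inr ⟨g, h, hg, hh, rfl⟩

theorem exists_leaf (T : PTree) : Nonempty (Leaves T) :=
  ⟨(exists_pos T (size_pos T)).choose⟩

theorem straight_injective {l r l' r' : PTree} : Function.Injective
    (fun p : (Leaves l ≃ Leaves l') × (Leaves r ≃ Leaves r') => straight p.1 p.2) := by
  rintro ⟨g, h⟩ ⟨g', h'⟩ he
  have e := fun x => congrArg (fun f : Leaves (node l r) ≃ Leaves (node l' r') => f x) he
  refine Prod.ext (Equiv.ext fun x => ?_) (Equiv.ext fun x => ?_)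
  · exact Sum.inl.inj (e (.inl x))
  · exact Sum.inr.inj (e (.inr x))

theorem crossed_injective {l r l' r' : PTree} : Function.Injective
    (fun p : (Leaves l ≃ Leaves r') × (Leaves r ≃ Leaves l') =>
      (crossed p.1 p.2 : Leaves (node l r) ≃ Leaves (node l' r'))) := by
  rintro ⟨g, h⟩ ⟨g', h'⟩ he
  have e := fun x => congrArg (fun f : Leaves (node l r) ≃ Leaves (node l' r') => f x) he
  refine Prod.ext (Equiv.ext fun x => ?_) (Equiv.ext fun x => ?_)
  · exact Sum.inr.inj (e (.inl x))
  · exact Sum.inl.inj (e (.inr x))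

theorem straight_ne_crossed {l r l' r' : PTree} (g : Leaves l ≃ Leaves l')
    (h : Leaves r ≃ Leaves r') (g' : Leaves l ≃ Leaves r') (h' : Leaves r ≃ Leaves l') :
    straight g h ≠ crossed g' h' := by
  intro he
  obtain ⟨x⟩ := exists_leaf l
  have e := congrArg (fun f : Leaves (node l r) ≃ Leaves (node l' r') => f (.inl x)) he
  exact Sum.inl_ne_inr e

/-- Summation over the isomorphisms of two nodes. -/
theorem sum_isos_node {M : Type*} [AddCommMonoid M] (l r l' r' : PTree)
    (f : (Leaves (node l r) ≃ Leaves (node l' r')) → M) :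
    ∑ e ∈ isos (node l r) (node l' r'), f e =
      ∑ g ∈ isos l l', ∑ h ∈ isos r r', f (straight g h) +
      ∑ g ∈ isos l r', ∑ h ∈ isos r l', f (crossed g h) := by
  rw [isos, Finset.sum_union, Finset.sum_image (fun _ _ _ _ h => straight_injective h),
    Finset.sum_image (fun _ _ _ _ h => crossed_injective h), Finset.sum_product,
    Finset.sum_product]
  rw [Finset.disjoint_left]
  intro e h1 h2
  obtain ⟨p, _, rfl⟩ := Finset.mem_image.mp h1
  obtain ⟨p', _, h⟩ := Finset.mem_image.mp h2
  exact straight_ne_crossed _ _ _ _ h.symm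

theorem card_isos_node (l r l' r' : PTree) : (isos (node l r) (node l' r')).card =
    (isos l l').card * (isos r r').card + (isos l r').card * (isos r l').card := by
  simp only [Finset.card_eq_sum_ones, sum_isos_node, Finset.sum_mul_sum, mul_one]

theorem length_isoFuns (T T' : PTree) : (isoFuns T T').length = (isos T T').card := by
  induction T generalizing T' with
  | leaf => cases T' <;> simp [isoFuns, isos]
  | node l r hl hr =>
    cases T' with
    | leaf => simp [isoFuns, isos]
    | node l' r' =>
      rw [card_isos_node, ← hl, ← hr, ← hl, ← hr, isoFuns, List.length_append]
      simp [List.length_flatMap]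

theorem exists_isos_of_mem_isoFuns {T T' : PTree} {f : ℕ → ℕ} (hf : f ∈ isoFuns T T') :
    ∃ e ∈ isos T T', ∀ x, f (pos T x) = pos T' (e x) := by
  induction T generalizing T' f with
  | leaf =>
    cases T' with
    | leaf =>
      rw [isoFuns, List.mem_singleton] at hf
      subst hf
      exact ⟨Equiv.refl _, by simp [isos], fun _ => rfl⟩
    | node l' r' => simp [isoFuns] at hf
  | node l r hl hr =>
    cases T' with
    | leaf => simp [isoFuns] at hf
    | node l' r' =>
      simp only [isoFuns, List.mem_append, List.mem_flatMap, List.mem_map] at hf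
      rcases hf with ⟨g, hg, h, hh, rfl⟩ | ⟨g, hg, h, hh, rfl⟩
      · obtain ⟨g', hg', eg⟩ := hl hg
        obtain ⟨h', hh', eh⟩ := hr hh
        refine ⟨straight g' h', mem_isos_node.mpr (Or.inl ⟨g', hg', h', hh', rfl⟩), ?_⟩
        rintro (x | x)
        · simp only [pos, if_pos (pos_lt l x), eg]; rfl
        · simp only [pos, if_neg (show ¬ pos r x + l.size < l.size by omega),
            Nat.add_sub_cancel, eh]; rfl
      · obtain ⟨g', hg', eg⟩ := hl hg
        obtain ⟨h', hh', eh⟩ := hr hh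
        refine ⟨crossed g' h', mem_isos_node.mpr (Or.inr ⟨g', hg', h', hh', rfl⟩), ?_⟩
        rintro (x | x)
        · simp only [pos, if_pos (pos_lt l x), eg]; rfl
        · simp only [pos, if_neg (show ¬ pos r x + l.size < l.size by omega),
            Nat.add_sub_cancel, eh]; rfl

theorem exists_isoFuns_of_mem_isos {T T' : PTree} {e : Leaves T ≃ Leaves T'}
    (he : e ∈ isos T T') : ∃ f ∈ isoFuns T T', ∀ x, f (pos T x) = pos T' (e x) := by
  induction T generalizing T' with
  | leaf =>
    cases T' with
    | leaf => exact ⟨fun i => i, by simp [isoFuns], fun _ => rfl⟩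
    | node l' r' => simp [isos] at he
  | node l r hl hr =>
    cases T' with
    | leaf => simp [isos] at he
    | node l' r' =>
      simp only [isoFuns, List.mem_append, List.mem_flatMap, List.mem_map]
      rcases mem_isos_node.mp he with ⟨g, hg, h, hh, rfl⟩ | ⟨g, hg, h, hh, rfl⟩
      · obtain ⟨g', hg', eg⟩ := hl hg
        obtain ⟨h', hh', eh⟩ := hr hh
        refine ⟨_, Or.inl ⟨g', hg', h', hh', rfl⟩, ?_⟩
        rintro (x | x)
        · simp only [pos, if_pos (pos_lt l x), eg]; rfl
        · simp only [pos, if_neg (show ¬ pos r x + l.size < l.size by omega),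
            Nat.add_sub_cancel, eh]; rfl
      · obtain ⟨g', hg', eg⟩ := hl hg
        obtain ⟨h', hh', eh⟩ := hr hh
        refine ⟨_, Or.inr ⟨g', hg', h', hh', rfl⟩, ?_⟩
        rintro (x | x)
        · simp only [pos, if_pos (pos_lt l x), eg]; rfl
        · simp only [pos, if_neg (show ¬ pos r x + l.size < l.size by omega),
            Nat.add_sub_cancel, eh]; rfl

theorem refl_mem_isos (T : PTree) : Equiv.refl _ ∈ isos T T := by
  induction T with
  | leaf => simp [isos]
  | node l r hl hr =>
    refine mem_isos_node.mpr (Or.inl ⟨_, hl, _, hr, Equiv.ext ?_⟩)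
    rintro (x | x) <;> rfl

theorem symm_mem_isos {T T' : PTree} {e : Leaves T ≃ Leaves T'} (he : e ∈ isos T T') :
    e.symm ∈ isos T' T := by
  induction T generalizing T' with
  | leaf =>
    cases T' with
    | leaf => rw [isos, Finset.mem_singleton] at he ⊢; rw [he]; rfl
    | node l' r' => simp [isos] at he
  | node l r hl hr =>
    cases T' with
    | leaf => simp [isos] at he
    | node l' r' =>
      rcases mem_isos_node.mp he with ⟨g, hg, h, hh, rfl⟩ | ⟨g, hg, h, hh, rfl⟩
      · refine mem_isos_node.mpr (Or.inl ⟨_, hl hg, _, hr hh, Equiv.ext ?_⟩)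
        rintro (x | x) <;> rfl
      · refine mem_isos_node.mpr (Or.inr ⟨_, hr hh, _, hl hg, Equiv.ext ?_⟩)
        rintro (x | x) <;> rfl

theorem trans_mem_isos {T T' T'' : PTree} {e : Leaves T ≃ Leaves T'}
    {e' : Leaves T' ≃ Leaves T''} (he : e ∈ isos T T') (he' : e' ∈ isos T' T'') :
    e.trans e' ∈ isos T T'' := by
  induction T generalizing T' T'' with
  | leaf =>
    cases T' with
    | leaf =>
      cases T'' with
      | leaf => rw [isos, Finset.mem_singleton] at *; rw [he, he']; rfl
      | node l'' r'' => simp [isos] at he'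
    | node l' r' => simp [isos] at he
  | node l r hl hr =>
    cases T' with
    | leaf => simp [isos] at he
    | node l' r' =>
      cases T'' with
      | leaf => simp [isos] at he'
      | node l'' r'' =>
        rcases mem_isos_node.mp he with ⟨g, hg, h, hh, rfl⟩ | ⟨g, hg, h, hh, rfl⟩ <;>
        rcases mem_isos_node.mp he' with ⟨g', hg', h', hh', rfl⟩ | ⟨g', hg', h', hh', rfl⟩
        · refine mem_isos_node.mpr (Or.inl ⟨_, hl hg hg', _, hr hh hh', Equiv.ext ?_⟩)
          rintro (x | x) <;> rfl
        · refine mem_isos_node.mpr (Or.inr ⟨_, hl hg hg', _, hr hh hh', Equiv.ext ?_⟩)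
          rintro (x | x) <;> rfl
        · refine mem_isos_node.mpr (Or.inr ⟨_, hl hg hh', _, hr hh hg', Equiv.ext ?_⟩)
          rintro (x | x) <;> rfl
        · refine mem_isos_node.mpr (Or.inl ⟨_, hl hg hh', _, hr hh hg', Equiv.ext ?_⟩)
          rintro (x | x) <;> rfl

theorem size_eq_of_mem_isos {T T' : PTree} {e : Leaves T ≃ Leaves T'} (_ : e ∈ isos T T') :
    T.size = T'.size := by
  rw [← card_leaves, ← card_leaves]
  exact Fintype.card_congr e

theorem isos_eq_empty_of_size_ne {T T' : PTree} (h : T.size ≠ T'.size) : isos T T' = ∅ :=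
  Finset.eq_empty_of_forall_notMem fun _ he => h (size_eq_of_mem_isos he)

theorem card_isos_eq {T T' : PTree} {e : Leaves T ≃ Leaves T'} (he : e ∈ isos T T') :
    (isos T T').card = (isos T T).card := by
  refine Finset.card_bij' (fun f _ => f.trans e.symm) (fun f _ => f.trans e) ?_ ?_ ?_ ?_
  · intro f hf; exact trans_mem_isos hf (symm_mem_isos he)
  · intro f hf; exact trans_mem_isos hf he
  · intro f _; ext x; simp
  · intro f _; ext x; simp

theorem encode_injective : Function.Injective encode := by
  intro T
  induction T with
  | leaf => intro T' h; cases T' <;> simp_all [encode]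
  | node l r hl hr =>
    intro T' h
    cases T' with
    | leaf => simp [encode] at h
    | node l' r' =>
      simp only [encode, Nat.add_right_cancel_iff, Nat.pair_eq_pair] at h
      rw [hl h.1, hr h.2]

theorem normalize_node (l r : PTree) : normalize (node l r) =
    if encode (normalize l) ≤ encode (normalize r) then node (normalize l) (normalize r)
    else node (normalize r) (normalize l) := rfl

theorem exists_isos_normalize (T : PTree) : (isos T (normalize T)).Nonempty := by
  induction T with
  | leaf => exact ⟨_, refl_mem_isos leaf⟩
  | node l r hl hr =>
    obtain ⟨g, hg⟩ := hl
    obtain ⟨h, hh⟩ := hr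
    by_cases hlr : encode (normalize l) ≤ encode (normalize r)
    · rw [normalize_node, if_pos hlr]
      exact ⟨straight g h, mem_isos_node.mpr (Or.inl ⟨g, hg, h, hh, rfl⟩)⟩
    · rw [normalize_node, if_neg hlr]
      exact ⟨crossed g h, mem_isos_node.mpr (Or.inr ⟨g, hg, h, hh, rfl⟩)⟩

theorem normalize_eq_of_mem_isos {T T' : PTree} {e : Leaves T ≃ Leaves T'}
    (he : e ∈ isos T T') : normalize T = normalize T' := by
  induction T generalizing T' with
  | leaf =>
    cases T' with
    | leaf => rfl
    | node l' r' => simp [isos] at he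
  | node l r hl hr =>
    cases T' with
    | leaf => simp [isos] at he
    | node l' r' =>
      rcases mem_isos_node.mp he with ⟨g, hg, h, hh, rfl⟩ | ⟨g, hg, h, hh, rfl⟩
      · rw [normalize_node, normalize_node, hl hg, hr hh]
      · rw [normalize_node, normalize_node, hl hg, hr hh]
        split_ifs with h1 h2 h2
        · rw [encode_injective (le_antisymm h1 h2)]
        · rfl
        · rfl
        · omega

theorem normalize_eq_iff {T T' : PTree} :
    normalize T = normalize T' ↔ (isos T T').Nonempty := by
  constructor
  · intro h
    obtain ⟨e, he⟩ := exists_isos_normalize T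
    have h' := exists_isos_normalize T'
    rw [← h] at h'
    obtain ⟨e', he'⟩ := h'
    exact ⟨_, trans_mem_isos he (symm_mem_isos he')⟩
  · rintro ⟨e, he⟩
    exact normalize_eq_of_mem_isos he

theorem hasBranch_of_mem_isos {B T T' : PTree} {e : Leaves T ≃ Leaves T'}
    (he : e ∈ isos T T') (hB : hasBranch B T) : hasBranch B T' := by
  cases T with
  | leaf => exact hB.elim
  | node l r =>
    cases T' with
    | leaf => simp [isos] at he
    | node l' r' =>
      simp only [hasBranch] at hB ⊢
      rcases mem_isos_node.mp he with ⟨g, hg, h, hh, rfl⟩ | ⟨g, hg, h, hh, rfl⟩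
      · rwa [← normalize_eq_of_mem_isos hg, ← normalize_eq_of_mem_isos hh]
      · rw [← normalize_eq_of_mem_isos hg, ← normalize_eq_of_mem_isos hh]; exact hB.symm

theorem planeTrees_one : planeTrees 1 = {leaf} := by rw [planeTrees]

theorem mem_planeTrees {n : ℕ} {T : PTree} : T ∈ planeTrees n ↔ T.size = n := by
  induction n using Nat.strong_induction_on generalizing T with
  | _ n ih =>
    match n, ih with
    | 0, _ => simp [planeTrees, (size_pos T).ne']
    | 1, _ =>
      rw [planeTrees, Finset.mem_singleton]
      constructor
      · rintro rfl; rfl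
      · intro h
        cases T with
        | leaf => rfl
        | node l r =>
          have h1 := size_pos l
          have h2 := size_pos r
          rw [size] at h; omega
    | n + 2, ih =>
      rw [planeTrees]
      simp only [Finset.mem_biUnion, Finset.mem_attach, true_and, Finset.mem_image,
        Finset.mem_product, Subtype.exists, Finset.mem_range, Prod.exists]
      constructor
      · rintro ⟨k, hk, l, r, ⟨hl, hr⟩, rfl⟩
        rw [ih _ (by omega)] at hl hr
        rw [size]; omega
      · intro h
        cases T with
        | leaf => rw [size] at h; omega
        | node l r =>
          have h1 := size_pos l
          have h2 := size_pos r
          rw [size] at h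
          refine ⟨l.size - 1, by omega, l, r, ⟨?_, ?_⟩, rfl⟩
          · rw [ih _ (by omega)]; omega
          · rw [ih _ (by omega)]; omega

theorem planeTrees_zero : planeTrees 0 = ∅ := by rw [planeTrees]

/-- Summation over plane trees by decomposition at the root. -/
theorem sum_planeTrees {M : Type*} [AddCommMonoid M] (f : PTree → M) (n : ℕ) :
    ∑ T ∈ planeTrees n, f T = (if n = 1 then f leaf else 0) +
      ∑ p ∈ Finset.HasAntidiagonal.antidiagonal n, ∑ l ∈ planeTrees p.1, ∑ r ∈ planeTrees p.2,
        f (node l r) := by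
  have key : planeTrees n = (if n = 1 then {leaf} else ∅) ∪
      (Finset.HasAntidiagonal.antidiagonal n).biUnion fun p =>
        (planeTrees p.1 ×ˢ planeTrees p.2).image fun q => node q.1 q.2 := by
    ext T
    simp only [Finset.mem_union, Finset.mem_biUnion, Finset.HasAntidiagonal.mem_antidiagonal, Finset.mem_image,
      Finset.mem_product, mem_planeTrees, Prod.exists]
    cases T with
    | leaf =>
      simp only [size]
      by_cases h : n = 1
      · simp [h]
      · simp [h, eq_comm]
    | node l r =>
      simp only [size]
      constructor
      · intro h; exact Or.inr ⟨_, _, h, l, r, ⟨rfl, rfl⟩, rfl⟩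
      · rintro (h | ⟨i, j, h, l', r', ⟨h1, h2⟩, h3⟩)
        · split_ifs at h <;> simp at h
        · injection h3 with h3 h4; subst h3 h4; omega
  rw [key, Finset.sum_union, Finset.sum_biUnion]
  · congr 1
    · split_ifs <;> simp
    · refine Finset.sum_congr rfl fun p _ => ?_
      rw [Finset.sum_image, Finset.sum_product]
      rintro ⟨a, b⟩ _ ⟨c, d⟩ _ h
      injection h with h1 h2
      exact Prod.ext h1 h2
  · intro p _ p' _ hne
    rw [Function.onFun, Finset.disjoint_left]
    intro T h1 h2
    obtain ⟨q, hq, rfl⟩ := Finset.mem_image.mp h1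
    obtain ⟨q', hq', h3⟩ := Finset.mem_image.mp h2
    injection h3 with h3 h4
    simp only [Finset.mem_product, mem_planeTrees] at hq hq'
    exact hne (Prod.ext (by rw [← hq.1, ← hq'.1, h3]) (by rw [← hq.2, ← hq'.2, h4]))
  · rw [Finset.disjoint_left]
    intro T h1 h2
    simp only [Finset.mem_biUnion, Finset.mem_image] at h2
    obtain ⟨_, _, _, _, rfl⟩ := h2
    split_ifs at h1 <;> simp at h1

/-- The total number of isomorphisms from a given tree to plane trees. -/
theorem sum_card_isos (T : PTree) (n : ℕ) : ∑ T' ∈ planeTrees n, (isos T T').card =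
    if n = T.size then 2 ^ (n - 1) else 0 := by
  induction T generalizing n with
  | leaf =>
    rw [sum_planeTrees]
    by_cases h : n = 1 <;> simp [h, isos, size]
  | node l r hl hr =>
    have h1 := size_pos l
    have h2 := size_pos r
    rw [sum_planeTrees]
    have h0 : (if n = 1 then (isos (node l r) leaf).card else 0) = 0 := by simp [isos]
    rw [h0, zero_add]
    simp only [card_isos_node, Finset.sum_add_distrib]
    have e1 : ∀ p : ℕ × ℕ, ∑ l' ∈ planeTrees p.1, ∑ r' ∈ planeTrees p.2,
        (isos l l').card * (isos r r').card = if p = (l.size, r.size) then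
          2 ^ (l.size - 1) * 2 ^ (r.size - 1) else 0 := by
      intro p
      rw [← Finset.sum_mul_sum, hl, hr]
      rcases p with ⟨i, j⟩
      simp only [Prod.mk.injEq]
      split_ifs <;> simp_all
    have e2 : ∀ p : ℕ × ℕ, ∑ l' ∈ planeTrees p.1, ∑ r' ∈ planeTrees p.2,
        (isos l r').card * (isos r l').card = if p = (r.size, l.size) then
          2 ^ (l.size - 1) * 2 ^ (r.size - 1) else 0 := by
      intro p
      rw [Finset.sum_comm, ← Finset.sum_mul_sum, hl, hr]
      rcases p with ⟨i, j⟩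
      simp only [Prod.mk.injEq]
      split_ifs <;> simp_all
    simp only [e1, e2, Finset.sum_ite_eq', Finset.HasAntidiagonal.mem_antidiagonal]
    have hs : (node l r).size = l.size + r.size := rfl
    by_cases h : n = l.size + r.size
    · rw [if_pos h.symm, if_pos (by omega), if_pos (h.trans hs.symm), ← pow_add, ← two_mul, ← pow_succ']
      congr 1
      omega
    · rw [if_neg (Ne.symm h), if_neg (by omega), if_neg (by omega), add_zero]

theorem card_isos_le (T T' : PTree) : (isos T T').card ≤ 2 ^ (T.size - 1) := by
  by_cases h : T'.size = T.size
  · have h1 := sum_card_isos T T.size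
    rw [if_pos rfl] at h1
    rw [← h1]
    exact Finset.single_le_sum (f := fun T' => (isos T T').card) (fun _ _ => Nat.zero_le _)
      (mem_planeTrees.mpr h)
  · rw [isos_eq_empty_of_size_ne (Ne.symm h)]
    simp

end PTree

/-- Weighted counting of the classes of an equivalence relation all of whose classes have the
same total weight. -/
theorem card_classes_mul {α : Type*} (X : Finset α) (R : α → α → Prop)
    (hrefl : ∀ t ∈ X, R t t) (hsymm : ∀ t ∈ X, ∀ t' ∈ X, R t t' → R t' t)
    (htrans : ∀ t ∈ X, ∀ t' ∈ X, ∀ t'' ∈ X, R t t' → R t' t'' → R t t'')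
    (w : α → ℕ) (W : ℕ) (hw : ∀ t ∈ X, ∑ t' ∈ X with R t t', w t' = W)
    (P : α → Prop) (hP : ∀ t ∈ X, ∀ t' ∈ X, R t t' → P t → P t') :
    ((X.image fun t => X.filter fun t' => R t t').filter fun c => ∃ t ∈ c, P t).card * W =
      ∑ t ∈ X with P t, w t := by
  rw [← Finset.sum_fiberwise_of_maps_to (s := X.filter P)
    (t := (X.image fun t => X.filter fun t' => R t t').filter fun c => ∃ t ∈ c, P t)
    (g := fun t => X.filter fun t' => R t t'), Finset.sum_const_nat]
  · intro c hc
    obtain ⟨hc, t1, ht1, hP1⟩ := Finset.mem_filter.mp hc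
    obtain ⟨t0, ht0, rfl⟩ := Finset.mem_image.mp hc
    rw [← hw t0 ht0]
    obtain ⟨ht1, h01⟩ := Finset.mem_filter.mp ht1
    refine Finset.sum_congr ?_ fun _ _ => rfl
    ext t
    simp only [Finset.mem_filter]
    constructor
    · rintro ⟨⟨ht, _⟩, he⟩
      refine ⟨ht, hsymm _ ht _ ht0 ?_⟩
      have : t0 ∈ X.filter fun t' => R t t' := by
        rw [he]; exact Finset.mem_filter.mpr ⟨ht0, hrefl _ ht0⟩
      exact (Finset.mem_filter.mp this).2
    · rintro ⟨ht, h⟩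
      refine ⟨⟨ht, hP _ ht1 _ ht (htrans _ ht1 _ ht0 _ ht (hsymm _ ht0 _ ht1 h01) h) hP1⟩, ?_⟩
      refine Finset.filter_congr fun t' ht' => ⟨fun h' => ?_, fun h' => ?_⟩
      · exact htrans _ ht0 _ ht _ ht' h h'
      · exact htrans _ ht _ ht0 _ ht' (hsymm _ ht0 _ ht h) h'
  · intro t ht
    obtain ⟨ht, hPt⟩ := Finset.mem_filter.mp ht
    exact Finset.mem_filter.mpr ⟨Finset.mem_image_of_mem _ ht, t,
      Finset.mem_filter.mpr ⟨ht, hrefl _ ht⟩, hPt⟩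

namespace PTree

/-- The leaves of a plane tree are numbered from left to right. -/
noncomputable def posEquiv (T : PTree) : Leaves T ≃ Fin T.size :=
  Equiv.ofBijective (fun x => ⟨pos T x, pos_lt T x⟩)
    ⟨fun _ _ h => pos_injective T (Fin.ext_iff.mp h),
      fun i => (exists_pos T i.2).imp fun _ h => Fin.ext h⟩

/-- The list of values of a matching of the leaves of two trees. -/
noncomputable def matchList {T S : PTree} (v : Leaves T ≃ Leaves S) : List ℕ :=
  List.ofFn fun i => pos S (v ((posEquiv T).symm i))

theorem getD_matchList {T S : PTree} (v : Leaves T ≃ Leaves S) (x : Leaves T) :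
    (matchList v).getD (pos T x) 0 = pos S (v x) := by
  have h : (posEquiv T).symm ⟨pos T x, pos_lt T x⟩ = x := (posEquiv T).symm_apply_apply x
  rw [matchList, List.getD_eq_getElem _ _ (by rw [List.length_ofFn]; exact pos_lt T x),
    List.getElem_ofFn, h]

theorem matchList_injective {T S : PTree} :
    Function.Injective (matchList : (Leaves T ≃ Leaves S) → List ℕ) := by
  intro v v' h
  refine Equiv.ext fun x => pos_injective S ?_
  rw [← getD_matchList, ← getD_matchList, h]

theorem image_matchList {n : ℕ} {T S : PTree} (hT : T.size = n) (hS : S.size = n) :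
    Finset.univ.image (matchList : (Leaves T ≃ Leaves S) → List ℕ) =
      (List.range n).permutations.toFinset := by
  refine Finset.eq_of_subset_of_card_le ?_ ?_
  · intro L hL
    obtain ⟨v, _, rfl⟩ := Finset.mem_image.mp hL
    rw [List.mem_toFinset, List.mem_permutations]
    have hnd : (matchList v).Nodup := by
      rw [matchList, List.nodup_ofFn]
      exact (pos_injective S).comp (v.injective.comp (posEquiv T).symm.injective)
    refine (List.perm_ext_iff_of_nodup hnd List.nodup_range).mpr fun i => ?_
    rw [matchList, List.mem_ofFn, List.mem_range]
    constructor
    · rintro ⟨j, rfl⟩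
      rw [← hS]
      exact pos_lt S _
    · intro hi
      obtain ⟨y, hy⟩ := exists_pos S (i := i) (by omega)
      exact ⟨posEquiv T (v.symm y), by simp [hy]⟩
  · rw [Finset.card_image_of_injective _ matchList_injective, Finset.card_univ,
      Fintype.card_equiv ((posEquiv T).trans ((finCongr (hT.trans hS.symm)).trans
        (posEquiv S).symm)), card_leaves, hT]
    refine (List.toFinset_card_le _).trans ?_
    rw [List.length_permutations, List.length_range]

theorem exists_matchList {n : ℕ} {t : PTree × PTree × List ℕ} (ht : t ∈ Triples n) :
    t.1.size = n ∧ t.2.1.size = n ∧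
      ∃ v : Leaves t.1 ≃ Leaves t.2.1, matchList v = t.2.2 := by
  simp only [Triples, Finset.mem_product, mem_planeTrees] at ht
  refine ⟨ht.1, ht.2.1, ?_⟩
  have h := ht.2.2
  rw [← image_matchList ht.1 ht.2.1] at h
  obtain ⟨v, _, hv⟩ := Finset.mem_image.mp h
  exact ⟨v, hv⟩

/-- Summation over triples. -/
theorem sum_triples {M : Type*} [AddCommMonoid M] (n : ℕ) (f : PTree × PTree × List ℕ → M) :
    ∑ t ∈ Triples n, f t = ∑ T ∈ planeTrees n, ∑ S ∈ planeTrees n,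
      ∑ v : Leaves T ≃ Leaves S, f (T, S, matchList v) := by
  rw [Triples, Finset.sum_product]
  refine Finset.sum_congr rfl fun T hT => ?_
  rw [Finset.sum_product]
  refine Finset.sum_congr rfl fun S hS => ?_
  rw [← image_matchList (mem_planeTrees.mp hT) (mem_planeTrees.mp hS),
    Finset.sum_image fun _ _ _ _ h => matchList_injective h]

/-- The isomorphisms between two triples. -/
noncomputable def links (t t' : PTree × PTree × List ℕ) :
    Finset ((Leaves t.1 ≃ Leaves t'.1) × (Leaves t.2.1 ≃ Leaves t'.2.1)) :=
  (isos t.1 t'.1 ×ˢ isos t.2.1 t'.2.1).filter fun p =>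
    ∀ x y, t.2.2.getD (pos _ x) 0 = pos _ y →
      t'.2.2.getD (pos _ (p.1 x)) 0 = pos _ (p.2 y)

theorem mem_links {t t' : PTree × PTree × List ℕ} {v : Leaves t.1 ≃ Leaves t.2.1}
    (hv : matchList v = t.2.2) {v' : Leaves t'.1 ≃ Leaves t'.2.1} (hv' : matchList v' = t'.2.2)
    {p : (Leaves t.1 ≃ Leaves t'.1) × (Leaves t.2.1 ≃ Leaves t'.2.1)} :
    p ∈ links t t' ↔ (p.1 ∈ isos t.1 t'.1 ∧ p.2 ∈ isos t.2.1 t'.2.1) ∧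
      p.1.trans v' = v.trans p.2 := by
  rw [links, Finset.mem_filter, Finset.mem_product, and_congr_right_iff]
  intro _
  simp only [← hv, ← hv', getD_matchList, (pos_injective _).eq_iff, forall_eq']
  exact ⟨fun h => Equiv.ext h, fun h x => Equiv.congr_fun h x⟩

theorem equivTriple_iff {n : ℕ} {t t' : PTree × PTree × List ℕ} (ht : t ∈ Triples n)
    (ht' : t' ∈ Triples n) : equivTriple n t t' = true ↔ (links t t').Nonempty := by
  obtain ⟨hT, hS, v, hv⟩ := exists_matchList ht
  obtain ⟨hT', hS', v', hv'⟩ := exists_matchList ht'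
  simp only [equivTriple, List.any_eq_true, List.all_eq_true, List.mem_range, beq_iff_eq]
  constructor
  · rintro ⟨f, hf, g, hg, h⟩
    obtain ⟨φ, hφ, eφ⟩ := exists_isos_of_mem_isoFuns hf
    obtain ⟨ψ, hψ, eψ⟩ := exists_isos_of_mem_isoFuns hg
    refine ⟨(φ, ψ), (mem_links hv hv').mpr ⟨⟨hφ, hψ⟩, Equiv.ext fun x => ?_⟩⟩
    have h1 := h (pos _ x) (hT ▸ pos_lt _ x)
    rw [eφ, ← hv, ← hv', getD_matchList, getD_matchList, eψ] at h1
    exact pos_injective _ h1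
  · rintro ⟨⟨φ, ψ⟩, hp⟩
    obtain ⟨⟨hφ, hψ⟩, h⟩ := (mem_links hv hv').mp hp
    obtain ⟨f, hf, eφ⟩ := exists_isoFuns_of_mem_isos hφ
    obtain ⟨g, hg, eψ⟩ := exists_isoFuns_of_mem_isos hψ
    refine ⟨f, hf, g, hg, fun i hi => ?_⟩
    obtain ⟨x, rfl⟩ := exists_pos t.1 (i := i) (by omega)
    rw [eφ, ← hv, ← hv', getD_matchList, getD_matchList, eψ]
    exact congrArg _ (Equiv.congr_fun h x)

theorem card_links_eq {n : ℕ} {t t' : PTree × PTree × List ℕ} (ht : t ∈ Triples n)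
    (ht' : t' ∈ Triples n) (h : (links t t').Nonempty) :
    (links t t').card = (links t' t').card := by
  obtain ⟨-, -, v, hv⟩ := exists_matchList ht
  obtain ⟨-, -, v', hv'⟩ := exists_matchList ht'
  obtain ⟨⟨φ, ψ⟩, hp⟩ := h
  obtain ⟨⟨hφ, hψ⟩, h⟩ := (mem_links hv hv').mp hp
  dsimp only at h hφ hψ
  have hx : ∀ x, v' (φ x) = ψ (v x) := fun x => Equiv.congr_fun h x
  have hx' : ∀ x, v (φ.symm x) = ψ.symm (v' x) := fun x => by
    rw [Equiv.eq_symm_apply, ← hx, Equiv.apply_symm_apply]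
  refine Finset.card_bij' (fun p _ => (φ.symm.trans p.1, ψ.symm.trans p.2))
    (fun p _ => (φ.trans p.1, ψ.trans p.2)) ?_ ?_ ?_ ?_
  · intro p hp
    obtain ⟨⟨h1, h2⟩, h3⟩ := (mem_links hv hv').mp hp
    refine (mem_links hv' hv').mpr ⟨⟨trans_mem_isos (symm_mem_isos hφ) h1,
      trans_mem_isos (symm_mem_isos hψ) h2⟩, Equiv.ext fun x => ?_⟩
    have := Equiv.congr_fun h3 (φ.symm x)
    simp only [Equiv.trans_apply] at this ⊢
    rw [this, hx']
  · intro p hp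
    obtain ⟨⟨h1, h2⟩, h3⟩ := (mem_links hv' hv').mp hp
    refine (mem_links hv hv').mpr ⟨⟨trans_mem_isos hφ h1, trans_mem_isos hψ h2⟩,
      Equiv.ext fun x => ?_⟩
    have := Equiv.congr_fun h3 (φ x)
    simp only [Equiv.trans_apply] at this ⊢
    rw [this, hx]
  · intro p _; ext x <;> simp
  · intro p _; ext x <;> simp

theorem links_symm {n : ℕ} {t t' : PTree × PTree × List ℕ} (ht : t ∈ Triples n)
    (ht' : t' ∈ Triples n) (h : (links t t').Nonempty) : (links t' t).Nonempty := by
  obtain ⟨-, -, v, hv⟩ := exists_matchList ht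
  obtain ⟨-, -, v', hv'⟩ := exists_matchList ht'
  obtain ⟨⟨φ, ψ⟩, hp⟩ := h
  obtain ⟨⟨hφ, hψ⟩, h⟩ := (mem_links hv hv').mp hp
  refine ⟨(φ.symm, ψ.symm), (mem_links hv' hv).mpr
    ⟨⟨symm_mem_isos hφ, symm_mem_isos hψ⟩, Equiv.ext fun x => ?_⟩⟩
  have := Equiv.congr_fun h (φ.symm x)
  simp only [Equiv.trans_apply, Equiv.apply_symm_apply] at this ⊢
  rw [Equiv.eq_symm_apply, this]

theorem links_trans {n : ℕ} {t t' t'' : PTree × PTree × List ℕ} (ht : t ∈ Triples n)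
    (ht' : t' ∈ Triples n) (ht'' : t'' ∈ Triples n) (h : (links t t').Nonempty)
    (h' : (links t' t'').Nonempty) : (links t t'').Nonempty := by
  obtain ⟨-, -, v, hv⟩ := exists_matchList ht
  obtain ⟨-, -, v', hv'⟩ := exists_matchList ht'
  obtain ⟨-, -, v'', hv''⟩ := exists_matchList ht''
  obtain ⟨⟨φ, ψ⟩, hp⟩ := h
  obtain ⟨⟨hφ, hψ⟩, h⟩ := (mem_links hv hv').mp hp
  obtain ⟨⟨φ', ψ'⟩, hp'⟩ := h'
  obtain ⟨⟨hφ', hψ'⟩, h'⟩ := (mem_links hv' hv'').mp hp'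
  refine ⟨(φ.trans φ', ψ.trans ψ'), (mem_links hv hv'').mpr
    ⟨⟨trans_mem_isos hφ hφ', trans_mem_isos hψ hψ'⟩, Equiv.ext fun x => ?_⟩⟩
  have h1 := Equiv.congr_fun h x
  have h2 := Equiv.congr_fun h' (φ x)
  simp only [Equiv.trans_apply] at h1 h2 ⊢
  rw [h2, h1]

theorem links_self {n : ℕ} {t : PTree × PTree × List ℕ} (ht : t ∈ Triples n) :
    (links t t).Nonempty := by
  obtain ⟨-, -, v, hv⟩ := exists_matchList ht
  exact ⟨(Equiv.refl _, Equiv.refl _), (mem_links hv hv).mpr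
    ⟨⟨refl_mem_isos _, refl_mem_isos _⟩, rfl⟩⟩

theorem sum_card_links {n : ℕ} {t : PTree × PTree × List ℕ} (ht : t ∈ Triples n) :
    ∑ t' ∈ Triples n, (links t t').card = 2 ^ (n - 1) * 2 ^ (n - 1) := by
  obtain ⟨hT, hS, v, hv⟩ := exists_matchList ht
  have h1 : ∀ T' S' : PTree, ∑ v' : Leaves T' ≃ Leaves S',
      (links t (T', S', matchList v')).card = (isos t.1 T').card * (isos t.2.1 S').card := by
    intro T' S'
    have h2 : ∀ v' : Leaves T' ≃ Leaves S', links t (T', S', matchList v') =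
        (isos t.1 T' ×ˢ isos t.2.1 S').filter fun p => p.1.symm.trans (v.trans p.2) = v' := by
      intro v'
      ext p
      rw [mem_links hv (t' := (T', S', matchList v')) rfl, Finset.mem_filter,
        Finset.mem_product, and_congr_right_iff]
      intro _
      constructor
      · intro h; rw [← h]; ext x; simp
      · intro h; rw [← h]; ext x; simp
    simp only [h2]
    rw [← Finset.card_product, Finset.card_eq_sum_card_fiberwise
      (f := fun p : (Leaves t.1 ≃ Leaves T') × (Leaves t.2.1 ≃ Leaves S') =>
        p.1.symm.trans (v.trans p.2)) (t := Finset.univ) (fun _ _ => Finset.mem_coe.mpr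
        (Finset.mem_univ _))]
  rw [sum_triples]
  simp only [h1]
  rw [← Finset.sum_mul_sum, sum_card_isos, sum_card_isos, if_pos hT.symm, if_pos hS.symm]

theorem card_links_matchList {T S : PTree} (v : Leaves T ≃ Leaves S) :
    (links (T, S, matchList v) (T, S, matchList v)).card =
      ∑ a ∈ isos T T, ∑ b ∈ isos S S, if a.trans v = v.trans b then 1 else 0 := by
  rw [← Finset.sum_product', ← Finset.card_filter]
  congr 1
  ext p
  rw [mem_links (t := (T, S, matchList v)) (t' := (T, S, matchList v)) rfl rfl,
    Finset.mem_filter, Finset.mem_product]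

theorem card_tangleClasses_mul (n : ℕ) (P : PTree × PTree × List ℕ → Prop)
    (hP : ∀ t t', (isos t.1 t'.1).Nonempty → P t → P t') :
    ((tangleClasses n).filter fun c => ∃ t ∈ c, P t).card * (2 ^ (n - 1) * 2 ^ (n - 1)) =
      ∑ t ∈ Triples n with P t, (links t t).card := by
  obtain ⟨R, hR⟩ : ∃ R : PTree × PTree × List ℕ → PTree × PTree × List ℕ → Prop,
    ∀ t t', R t t' ↔ (links t t').Nonempty := ⟨_, fun _ _ => Iff.rfl⟩
  have h0 : tangleClasses n = (Triples n).image fun t => (Triples n).filter fun t' => R t t' := by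
    rw [tangleClasses]
    refine Finset.image_congr fun t ht => ?_
    refine Finset.filter_congr fun t' ht' => ?_
    rw [hR]
    exact equivTriple_iff ht ht'
  have hw : ∀ t ∈ Triples n, ∑ t' ∈ Triples n with R t t', (links t' t').card =
      2 ^ (n - 1) * 2 ^ (n - 1) := by
    intro t ht
    rw [← sum_card_links ht, Finset.sum_filter]
    refine Finset.sum_congr rfl fun t' ht' => ?_
    split_ifs with h
    · exact (card_links_eq ht ht' ((hR _ _).mp h)).symm
    · rw [hR, Finset.not_nonempty_iff_eq_empty] at h
      rw [h, Finset.card_empty]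
  have hinv : ∀ t ∈ Triples n, ∀ t' ∈ Triples n, R t t' → P t → P t' := by
    intro t _ t' _ h
    obtain ⟨p, hp⟩ := (hR _ _).mp h
    exact hP t t' ⟨p.1, (Finset.mem_product.mp (Finset.mem_filter.mp hp).1).1⟩
  have key := card_classes_mul (Triples n) R (fun t ht => (hR _ _).mpr (links_self ht))
    (fun t ht t' ht' h => (hR _ _).mpr (links_symm ht ht' ((hR _ _).mp h)))
    (fun t ht t' ht' t'' ht'' h h' =>
      (hR _ _).mpr (links_trans ht ht' ht'' ((hR _ _).mp h) ((hR _ _).mp h')))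
    (fun t => (links t t).card) _ hw P hinv
  rw [← key, h0]
  congr!

/-- The number of pairs of automorphisms with compatible matchings. -/
theorem sum_card_links_self (n : ℕ) (Q : PTree → Prop) :
    ∑ t ∈ Triples n with Q t.1, (links t t).card =
      ∑ T ∈ planeTrees n with Q T, ∑ S ∈ planeTrees n, ∑ a ∈ isos T T, ∑ b ∈ isos S S,
        (Finset.univ.filter fun v : Leaves T ≃ Leaves S => a.trans v = v.trans b).card := by
  rw [Finset.sum_filter, sum_triples, Finset.sum_filter]
  refine Finset.sum_congr rfl fun T _ => ?_
  have h : ∀ S (v : Leaves T ≃ Leaves S), (if Q (T, S, matchList v).1 then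
      (links (T, S, matchList v) (T, S, matchList v)).card else 0) = if Q T then
      ∑ a ∈ isos T T, ∑ b ∈ isos S S, if a.trans v = v.trans b then 1 else 0 else 0 :=
    fun S v => by rw [card_links_matchList]
  simp only [h]
  split_ifs
  · refine Finset.sum_congr rfl fun S _ => ?_
    simp only [Finset.card_filter]
    rw [Finset.sum_comm]
    refine Finset.sum_congr rfl fun a _ => ?_
    rw [Finset.sum_comm]
  · simp

end PTree

section

open scoped Nat

/-- The order of the centralizer of a permutation of `n` points with cycle type `μ`. -/
noncomputable def centralizerCard (n : ℕ) (μ : Multiset ℕ) : ℕ :=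
  (n - μ.sum)! * μ.prod * ∏ i ∈ μ.toFinset, (μ.count i)!

theorem cycleType_eq_of_injective {α β : Type*} [Fintype α] [Fintype β] {f : α → β}
    (hf : Function.Injective f) {a : Equiv.Perm α} {b : Equiv.Perm β}
    (h : ∀ x, b (f x) = f (a x)) (h' : ∀ y, y ∉ Set.range f → b y = y) :
    b.cycleType = a.cycleType := by
  have hb : b = a.extendDomain (p := fun y => y ∈ Set.range f) (Equiv.ofInjective f hf) := by
    ext y
    by_cases hy : y ∈ Set.range f
    · obtain ⟨x, rfl⟩ := hy
      rw [h]
      exact (Equiv.Perm.extendDomain_apply_image a (Equiv.ofInjective f hf) x).symm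
    · rw [Equiv.Perm.extendDomain_apply_not_subtype _ _ hy, h' y hy]
  rw [hb, Equiv.Perm.cycleType_extendDomain]

theorem card_intertwining {α β : Type*} [Fintype α] [Fintype β]
    (hc : Fintype.card α = Fintype.card β) (a : Equiv.Perm α) (b : Equiv.Perm β) :
    (Finset.univ.filter fun v : α ≃ β => a.trans v = v.trans b).card =
      if a.cycleType = b.cycleType then centralizerCard (Fintype.card α) a.cycleType else 0 := by
  split_ifs with h
  · let e := Fintype.equivOfCardEq hc
    let b' : Equiv.Perm α := e.trans (b.trans e.symm)
    have h1 : b'.cycleType = b.cycleType := by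
      refine (cycleType_eq_of_injective e.injective (fun x => ?_) fun y hy => ?_).symm
      · simp [b']
      · exact (hy (e.surjective y)).elim
    rw [← h1, ← Equiv.Perm.isConj_iff_cycleType_eq, isConj_iff] at h
    obtain ⟨c, hc⟩ := h
    have h2 : ∀ x, b (e (c x)) = e (c (a x)) := fun x => by
      have := Equiv.congr_fun hc (c x)
      simp only [Equiv.Perm.mul_apply, Equiv.Perm.inv_def, Equiv.symm_apply_apply,
        Equiv.trans_apply, b'] at this
      rw [this, Equiv.apply_symm_apply]
    have h3 : ∀ y, c.symm (e.symm (b y)) = a (c.symm (e.symm y)) := fun y => by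
      rw [Equiv.symm_apply_eq, Equiv.symm_apply_eq, ← h2, Equiv.apply_symm_apply,
        Equiv.apply_symm_apply]
    rw [centralizerCard, ← Equiv.Perm.nat_card_centralizer, Nat.card_eq_fintype_card,
      ← Fintype.card_coe]
    refine Fintype.card_congr
      { toFun := fun v => ⟨(v.1.trans e.symm).trans c.symm, ?_⟩
        invFun := fun d => ⟨(d.1.trans c).trans e, ?_⟩
        left_inv := fun v => ?_
        right_inv := fun d => ?_ }
    · have hv := (Finset.mem_filter.mp v.2).2
      rw [Subgroup.mem_centralizer_singleton_iff]
      ext x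
      have := Equiv.congr_fun hv x
      simp only [Equiv.trans_apply] at this
      simp [this, h3]
    · have hd := d.2
      rw [Subgroup.mem_centralizer_singleton_iff] at hd
      refine Finset.mem_filter.mpr ⟨Finset.mem_univ _, Equiv.ext fun x => ?_⟩
      have := Equiv.congr_fun hd x
      simp only [Equiv.Perm.mul_apply] at this
      simp [this, h2]
    · ext x; simp
    · ext x; simp
  · rw [Finset.card_eq_zero, Finset.filter_eq_empty_iff]
    intro v _ hv
    refine h (cycleType_eq_of_injective v.injective (fun x => ?_) fun y hy => ?_).symm
    · exact (Equiv.congr_fun hv x).symm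
    · exact (hy (v.surjective y)).elim

/-- The cycle types of permutations moving `k` points. -/
noncomputable def cycleTypes (k : ℕ) : Finset (Multiset ℕ) :=
  ((Finset.univ : Finset (Nat.Partition k)).image Nat.Partition.parts).filter
    fun μ => ∀ i ∈ μ, 2 ≤ i

theorem mem_cycleTypes {k : ℕ} {μ : Multiset ℕ} :
    μ ∈ cycleTypes k ↔ μ.sum = k ∧ ∀ i ∈ μ, 2 ≤ i := by
  rw [cycleTypes, Finset.mem_filter, Finset.mem_image, and_congr_left_iff]
  intro h
  constructor
  · rintro ⟨p, _, rfl⟩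
    exact p.parts_sum
  · intro hk
    exact ⟨⟨μ, fun {i} hi => by have := h i hi; omega, hk⟩, Finset.mem_univ _, rfl⟩

/-- Summation over all cycle types of permutations of `n` points. -/
theorem sum_cycleTypes_eq {α : Type*} [Fintype α] {n : ℕ} (hn : Fintype.card α = n)
    (a : Equiv.Perm α) (f : Multiset ℕ → ℕ) :
    ∑ k ∈ Finset.range (n + 1), ∑ μ ∈ cycleTypes k, (if a.cycleType = μ then f μ else 0) =
      f a.cycleType := by
  have h := a.sum_cycleType_le
  have hm : a.cycleType ∈ cycleTypes a.cycleType.sum :=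
    mem_cycleTypes.mpr ⟨rfl, fun i hi => Equiv.Perm.two_le_of_mem_cycleType hi⟩
  rw [Finset.sum_eq_single a.cycleType.sum, Finset.sum_eq_single a.cycleType]
  · rw [if_pos rfl]
  · intro μ _ hμ
    rw [if_neg hμ.symm]
  · intro h'; exact absurd hm h'
  · intro k _ hk
    refine Finset.sum_eq_zero fun μ hμ => if_neg ?_
    rintro rfl
    exact hk (mem_cycleTypes.mp hμ).1.symm
  · intro h'
    exact absurd (Finset.mem_range.mpr (by omega)) h'

namespace PTree

/-- The number of automorphisms of a tree with given cycle type. -/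
noncomputable def autCount (T : PTree) (μ : Multiset ℕ) : ℕ :=
  ((isos T T).filter fun a : Equiv.Perm (Leaves T) => a.cycleType = μ).card

/-- The number of automorphisms with given cycle type of the trees of size `n` satisfying
a property. -/
noncomputable def totalAutCount (Q : PTree → Prop) (n : ℕ) (μ : Multiset ℕ) : ℕ :=
  ∑ T ∈ planeTrees n with Q T, autCount T μ

theorem autCount_eq_sum (T : PTree) (μ : Multiset ℕ) : autCount T μ =
    ∑ a ∈ isos T T, if Equiv.Perm.cycleType (α := Leaves T) a = μ then 1 else 0 :=
  Finset.card_filter _ _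

theorem sum_card_links_eq (n : ℕ) (Q : PTree → Prop) :
    ∑ t ∈ Triples n with Q t.1, (links t t).card =
      ∑ k ∈ Finset.range (n + 1), ∑ μ ∈ cycleTypes k,
        centralizerCard n μ * (totalAutCount Q n μ * totalAutCount (fun _ => True) n μ) := by
  have h1 : ∀ T ∈ planeTrees n, ∀ S ∈ planeTrees n,
      ∑ a ∈ isos T T, ∑ b ∈ isos S S,
        (Finset.univ.filter fun v : Leaves T ≃ Leaves S => a.trans v = v.trans b).card =
      ∑ k ∈ Finset.range (n + 1), ∑ μ ∈ cycleTypes k,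
        centralizerCard n μ * (autCount T μ * autCount S μ) := by
    intro T hT S hS
    have hT' := (card_leaves T).trans (mem_planeTrees.mp hT)
    have hS' := (card_leaves S).trans (mem_planeTrees.mp hS)
    have h2 : ∀ (a : Equiv.Perm (Leaves T)) (b : Equiv.Perm (Leaves S)),
        (Finset.univ.filter fun v : Leaves T ≃ Leaves S => a.trans v = v.trans b).card =
        ∑ k ∈ Finset.range (n + 1), ∑ μ ∈ cycleTypes k, centralizerCard n μ *
          ((if a.cycleType = μ then 1 else 0) * (if b.cycleType = μ then 1 else 0)) := by
      intro a b
      rw [card_intertwining (hT'.trans hS'.symm), hT', eq_comm]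
      have := sum_cycleTypes_eq hT' a
        (fun μ => centralizerCard n μ * if b.cycleType = μ then 1 else 0)
      simp only [eq_comm (a := b.cycleType), mul_ite, mul_one, mul_zero] at this
      rw [← this]
      refine Finset.sum_congr rfl fun k _ => Finset.sum_congr rfl fun μ _ => ?_
      by_cases ha : a.cycleType = μ
      · by_cases hb : b.cycleType = μ
        · simp [ha, hb]
        · simp [ha, hb, Ne.symm hb]
      · simp [ha]
    simp only [autCount_eq_sum, Finset.sum_mul_sum]
    simp only [Finset.mul_sum]
    rw [Finset.sum_congr rfl fun a _ => Finset.sum_congr rfl fun b _ => h2 a b]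
    rw [Finset.sum_congr rfl fun a _ => Finset.sum_comm, Finset.sum_comm]
    refine Finset.sum_congr rfl fun k _ => ?_
    rw [Finset.sum_congr rfl fun a _ => Finset.sum_comm, Finset.sum_comm]
  rw [sum_card_links_self, Finset.sum_congr rfl fun T hT => Finset.sum_congr rfl fun S hS =>
    h1 T (Finset.mem_filter.mp hT).1 S hS]
  simp only [totalAutCount, Finset.filter_true, Finset.sum_mul_sum]
  simp only [Finset.mul_sum]
  rw [Finset.sum_congr rfl fun a _ => Finset.sum_comm, Finset.sum_comm]
  refine Finset.sum_congr rfl fun k _ => ?_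
  rw [Finset.sum_congr rfl fun a _ => Finset.sum_comm, Finset.sum_comm]

theorem cycleType_straight {l r : PTree} (g : Equiv.Perm (Leaves l)) (h : Equiv.Perm (Leaves r)) :
    Equiv.Perm.cycleType (α := Leaves (node l r)) (straight g h) = g.cycleType + h.cycleType := by
  have h1 : (straight g h : Equiv.Perm (Leaves (node l r))) =
      (straight g (Equiv.refl _) : Equiv.Perm (Leaves (node l r))) *
      (straight (Equiv.refl _) h : Equiv.Perm (Leaves (node l r))) := by
    refine Equiv.ext ?_
    rintro (x | x) <;> rfl
  have hd : Equiv.Perm.Disjoint (straight g (Equiv.refl _) : Equiv.Perm (Leaves (node l r)))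
      (straight (Equiv.refl _) h : Equiv.Perm (Leaves (node l r))) := by
    rintro (x | x)
    · exact Or.inr rfl
    · exact Or.inl rfl
  rw [h1, hd.cycleType_mul]
  congr 1
  · refine cycleType_eq_of_injective (f := fun x : Leaves l => (Sum.inl x : Leaves (node l r)))
      Sum.inl_injective (fun x => rfl) ?_
    rintro (x | x) hx
    · exact (hx ⟨x, rfl⟩).elim
    · rfl
  · refine cycleType_eq_of_injective (f := fun x : Leaves r => (Sum.inr x : Leaves (node l r)))
      Sum.inr_injective (fun x => rfl) ?_
    rintro (x | x) hx
    · rfl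
    · exact (hx ⟨x, rfl⟩).elim

theorem sum_cycleType_crossed {l r : PTree} (g : Leaves l ≃ Leaves r) (h : Leaves r ≃ Leaves l) :
    (Equiv.Perm.cycleType (α := Leaves (node l r)) (crossed g h)).sum = (node l r).size := by
  rw [Equiv.Perm.sum_cycleType, ← card_leaves, ← Finset.card_univ]
  congr 1
  rw [Finset.eq_univ_iff_forall]
  intro x
  rw [Equiv.Perm.mem_support]
  rcases x with x | x
  · exact Sum.inr_ne_inl
  · exact Sum.inl_ne_inr

/-- The number of automorphisms exchanging the two branches, with given cycle type. -/
noncomputable def crossCount (l r : PTree) (μ : Multiset ℕ) : ℕ :=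
  ∑ g ∈ isos l r, ∑ h ∈ isos r l,
    if Equiv.Perm.cycleType (α := Leaves (node l r)) (crossed g h) = μ then 1 else 0

theorem crossCount_eq_zero {l r : PTree} {μ : Multiset ℕ} (h : μ.sum ≠ (node l r).size) :
    crossCount l r μ = 0 := by
  refine Finset.sum_eq_zero fun g _ => Finset.sum_eq_zero fun g' _ => if_neg ?_
  rintro rfl
  exact h (sum_cycleType_crossed g g')

theorem autCount_leaf (μ : Multiset ℕ) : autCount leaf μ = if μ = 0 then 1 else 0 := by
  rw [autCount_eq_sum, isos, Finset.sum_singleton]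
  have : Equiv.Perm.cycleType (α := Leaves leaf) (Equiv.refl _) = 0 := Equiv.Perm.cycleType_one
  rw [this]
  simp only [eq_comm]

theorem autCount_node (l r : PTree) (μ : Multiset ℕ) : autCount (node l r) μ =
    ∑ ν ∈ Finset.Iic μ, autCount l ν * autCount r (μ - ν) + crossCount l r μ := by
  rw [autCount_eq_sum, sum_isos_node, crossCount]
  congr 1
  simp only [autCount_eq_sum, Finset.sum_mul_sum]
  symm
  rw [Finset.sum_comm]
  refine Finset.sum_congr rfl fun g _ => ?_
  rw [Finset.sum_comm]
  refine Finset.sum_congr rfl fun h _ => ?_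
  rw [cycleType_straight]
  generalize Equiv.Perm.cycleType (α := Leaves l) g = x
  generalize Equiv.Perm.cycleType (α := Leaves r) h = y
  simp only [ite_mul, one_mul, zero_mul, Finset.sum_ite_eq, Finset.mem_Iic]
  by_cases hx : x ≤ μ
  · rw [if_pos hx]
    refine if_congr ?_ rfl rfl
    rw [eq_tsub_iff_add_eq_of_le hx, add_comm]
  · rw [if_neg hx, if_neg]
    rintro rfl
    exact hx (Multiset.le_add_right _ _)

theorem sum_autCount (n : ℕ) (μ : Multiset ℕ) : ∑ T ∈ planeTrees n, autCount T μ =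
    (if μ = 0 then if n = 1 then 1 else 0 else 0) +
    ∑ ν ∈ Finset.Iic μ, ∑ p ∈ Finset.HasAntidiagonal.antidiagonal n,
      (∑ l ∈ planeTrees p.1, autCount l ν) * (∑ r ∈ planeTrees p.2, autCount r (μ - ν)) +
    ∑ p ∈ Finset.HasAntidiagonal.antidiagonal n, ∑ l ∈ planeTrees p.1, ∑ r ∈ planeTrees p.2,
      crossCount l r μ := by
  rw [sum_planeTrees, autCount_leaf, add_assoc]
  congr 1
  · by_cases h1 : n = 1 <;> by_cases h2 : μ = 0 <;> simp [h1, h2]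
  · simp only [autCount_node, Finset.sum_add_distrib, Finset.sum_mul_sum]
    congr 1
    symm
    rw [Finset.sum_comm]
    refine Finset.sum_congr rfl fun p _ => ?_
    rw [Finset.sum_comm]
    refine Finset.sum_congr rfl fun l _ => ?_
    rw [Finset.sum_comm]

/-- The generating function of the automorphisms with given cycle type. -/
noncomputable def autSeries (μ : Multiset ℕ) : PowerSeries ℝ :=
  PowerSeries.mk fun n => (totalAutCount (fun _ => True) n μ : ℝ)

/-- The generating function of the automorphisms exchanging the root branches, with given
cycle type. -/
noncomputable def crossSeries (μ : Multiset ℕ) : PowerSeries ℝ :=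
  PowerSeries.mk fun n => ((∑ p ∈ Finset.HasAntidiagonal.antidiagonal n,
    ∑ l ∈ planeTrees p.1, ∑ r ∈ planeTrees p.2, crossCount l r μ : ℕ) : ℝ)

theorem coeff_autSeries (μ : Multiset ℕ) (n : ℕ) : PowerSeries.coeff n (autSeries μ) =
    ((∑ T ∈ planeTrees n, autCount T μ : ℕ) : ℝ) := by
  rw [autSeries, PowerSeries.coeff_mk, totalAutCount, Finset.filter_true]

theorem sum_crossCount_eq_zero {n : ℕ} {μ : Multiset ℕ} (h : μ.sum ≠ n) :
    ∑ p ∈ Finset.HasAntidiagonal.antidiagonal n,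
      ∑ l ∈ planeTrees p.1, ∑ r ∈ planeTrees p.2, crossCount l r μ = 0 := by
  refine Finset.sum_eq_zero fun p hp => Finset.sum_eq_zero fun l hl =>
    Finset.sum_eq_zero fun r hr => crossCount_eq_zero fun h' => h ?_
  rw [h', size, mem_planeTrees.mp hl, mem_planeTrees.mp hr,
    Finset.HasAntidiagonal.mem_antidiagonal.mp hp]

theorem branchSystem : BranchSystem autSeries crossSeries where
  nonneg μ n := by rw [coeff_autSeries]; positivity
  corr_nonneg μ n := by rw [crossSeries, PowerSeries.coeff_mk]; positivity
  corr_finite μ := ⟨μ.sum + 1, fun n hn => by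
    rw [crossSeries, PowerSeries.coeff_mk, sum_crossCount_eq_zero (by omega), Nat.cast_zero]⟩
  corr_zero := by
    ext n
    rw [crossSeries, PowerSeries.coeff_mk, map_zero]
    rcases Nat.eq_zero_or_pos n with rfl | hn
    · simp [planeTrees_zero]
    · rw [sum_crossCount_eq_zero (by rw [Multiset.sum_zero]; omega), Nat.cast_zero]
  const μ := by
    rw [← PowerSeries.coeff_zero_eq_constantCoeff_apply, coeff_autSeries, planeTrees_zero]
    simp
  rec_eq μ := by
    ext n
    rw [coeff_autSeries, sum_autCount, map_add, map_add, map_sum, crossSeries,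
      PowerSeries.coeff_mk]
    simp only [PowerSeries.coeff_mul, coeff_autSeries]
    push_cast
    congr 2
    split_ifs with _ h2
    · rw [h2, PowerSeries.coeff_one_X]
    · rw [PowerSeries.coeff_X, if_neg h2]
    · rw [map_zero]

end PTree

namespace PTree

open Filter Topology

theorem totalAutCount_le (Q : PTree → Prop) (n : ℕ) (μ : Multiset ℕ) :
    totalAutCount Q n μ ≤ totalAutCount (fun _ => True) n μ := by
  rw [totalAutCount, totalAutCount, Finset.filter_true]
  exact Finset.sum_le_sum_of_subset (Finset.filter_subset _ _)

theorem size_eq_of_normalize_eq {T T' : PTree} (h : normalize T = normalize T') :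
    T.size = T'.size := by
  obtain ⟨e, he⟩ := normalize_eq_iff.mp h
  exact size_eq_of_mem_isos he

theorem crossCount_eq_zero_of_size_ne {l r : PTree} (h : l.size ≠ r.size) (μ : Multiset ℕ) :
    crossCount l r μ = 0 := by
  rw [crossCount, isos_eq_empty_of_size_ne h, Finset.sum_empty]

theorem sum_autCount_mul_comm (l r : PTree) (μ : Multiset ℕ) :
    ∑ ν ∈ Finset.Iic μ, autCount l ν * autCount r (μ - ν) =
      ∑ ν ∈ Finset.Iic μ, autCount r ν * autCount l (μ - ν) := by
  refine Finset.sum_nbij' (fun ν => μ - ν) (fun ν => μ - ν) ?_ ?_ ?_ ?_ ?_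
  · intro ν _; exact Finset.mem_Iic.mpr tsub_le_self
  · intro ν _; exact Finset.mem_Iic.mpr tsub_le_self
  · intro ν hν; exact tsub_tsub_cancel_of_le (Finset.mem_Iic.mp hν)
  · intro ν hν; exact tsub_tsub_cancel_of_le (Finset.mem_Iic.mp hν)
  · intro ν hν
    rw [tsub_tsub_cancel_of_le (Finset.mem_Iic.mp hν), mul_comm]

theorem totalAutCount_hasBranch (B : PTree) {n : ℕ} (hn : 2 * B.size < n) (μ : Multiset ℕ) :
    totalAutCount (hasBranch B) n μ = 2 * ∑ ν ∈ Finset.Iic μ,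
      totalAutCount (fun l => normalize l = normalize B) B.size ν *
        totalAutCount (fun _ => True) (n - B.size) (μ - ν) := by
  have h1 : ∀ p ∈ Finset.HasAntidiagonal.antidiagonal n, ∀ l ∈ planeTrees p.1,
      ∀ r ∈ planeTrees p.2,
      (if hasBranch B (node l r) then autCount (node l r) μ else 0) =
      (if normalize l = normalize B then
        ∑ ν ∈ Finset.Iic μ, autCount l ν * autCount r (μ - ν) else 0) +
      (if normalize r = normalize B then
        ∑ ν ∈ Finset.Iic μ, autCount r ν * autCount l (μ - ν) else 0) := by
    intro p hp l hl r hr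
    rw [Finset.HasAntidiagonal.mem_antidiagonal] at hp
    rw [mem_planeTrees] at hl hr
    by_cases h2 : normalize l = normalize B
    · have h3 := size_eq_of_normalize_eq h2
      have h4 : normalize r ≠ normalize B := fun h => by
        have := size_eq_of_normalize_eq h; omega
      rw [if_pos (show hasBranch B (node l r) from Or.inl h2), if_pos h2, if_neg h4, autCount_node,
        crossCount_eq_zero_of_size_ne (by omega)]
    · by_cases h4 : normalize r = normalize B
      · have h3 := size_eq_of_normalize_eq h4
        rw [if_pos (show hasBranch B (node l r) from Or.inr h4), if_neg h2, if_pos h4, autCount_node,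
          crossCount_eq_zero_of_size_ne (by omega), sum_autCount_mul_comm, add_comm]
      · rw [if_neg h2, if_neg h4,
          if_neg (show ¬ hasBranch B (node l r) from fun h => h.elim h2 h4)]
  have h2 : ∀ m, ∑ l ∈ planeTrees B.size, ∑ r ∈ planeTrees m,
      (if normalize l = normalize B then
        ∑ ν ∈ Finset.Iic μ, autCount l ν * autCount r (μ - ν) else 0) =
      ∑ ν ∈ Finset.Iic μ, totalAutCount (fun l => normalize l = normalize B) B.size ν *
        totalAutCount (fun _ => True) m (μ - ν) := by
    intro m
    simp only [totalAutCount, Finset.filter_true, Finset.sum_mul_sum]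
    symm
    rw [Finset.sum_comm, Finset.sum_filter]
    refine Finset.sum_congr rfl fun l _ => ?_
    split_ifs
    · rw [Finset.sum_comm]
    · simp
  rw [totalAutCount, Finset.sum_filter, sum_planeTrees]
  have h0 : (if n = 1 then if hasBranch B leaf then autCount leaf μ else 0 else 0) = 0 := by
    rw [if_neg (show ¬ hasBranch B leaf from id)]; simp
  rw [h0, zero_add, Finset.sum_congr rfl fun p hp => Finset.sum_congr rfl fun l hl =>
    Finset.sum_congr rfl fun r hr => h1 p hp l hl r hr]
  simp only [Finset.sum_add_distrib]
  rw [two_mul]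
  congr 1
  · rw [Finset.sum_eq_single (B.size, n - B.size)]
    · exact h2 _
    · intro p hp hne
      rw [Finset.HasAntidiagonal.mem_antidiagonal] at hp
      refine Finset.sum_eq_zero fun l hl => Finset.sum_eq_zero fun r hr => if_neg fun h => hne ?_
      rw [mem_planeTrees] at hl hr
      have := size_eq_of_normalize_eq h
      exact Prod.ext (by dsimp only; omega) (by dsimp only; omega)
    · intro h
      refine absurd (Finset.HasAntidiagonal.mem_antidiagonal.mpr ?_) h
      dsimp only; omega
  · rw [Finset.sum_eq_single (n - B.size, B.size)]
    · rw [Finset.sum_comm]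
      exact h2 _
    · intro p hp hne
      rw [Finset.HasAntidiagonal.mem_antidiagonal] at hp
      refine Finset.sum_eq_zero fun l hl => Finset.sum_eq_zero fun r hr => if_neg fun h => hne ?_
      rw [mem_planeTrees] at hl hr
      have := size_eq_of_normalize_eq h
      exact Prod.ext (by dsimp only; omega) (by dsimp only; omega)
    · intro h
      refine absurd (Finset.HasAntidiagonal.mem_antidiagonal.mpr ?_) h
      dsimp only; omega

theorem autCount_zero (T : PTree) : autCount T 0 = 1 := by
  rw [autCount, Finset.card_eq_one]
  refine ⟨Equiv.refl _, ?_⟩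
  ext a
  rw [Finset.mem_filter, Finset.mem_singleton, Equiv.Perm.cycleType_eq_zero]
  exact ⟨fun h => h.2, fun h => ⟨h ▸ refl_mem_isos T, h⟩⟩

theorem totalAutCount_zero_mul (B : PTree) :
    totalAutCount (fun l => normalize l = normalize B) B.size 0 * (isos B B).card =
      2 ^ (B.size - 1) := by
  have h := sum_card_isos B B.size
  rw [if_pos rfl] at h
  rw [← h, totalAutCount]
  simp only [autCount_zero]
  rw [Finset.sum_mul, Finset.sum_filter]
  refine Finset.sum_congr rfl fun T _ => ?_
  split_ifs with h1
  · obtain ⟨e, he⟩ := normalize_eq_iff.mp h1.symm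
    rw [one_mul, card_isos_eq he]
  · rw [Finset.not_nonempty_iff_eq_empty.mp (fun h2 => h1 (normalize_eq_iff.mpr h2).symm),
      Finset.card_empty]

/-- The limiting proportion of the trees with a given root branch, among the trees decorated
with an automorphism of given cycle type. -/
theorem tendsto_hasBranch_ratio (B : PTree) {μ : Multiset ℕ} (hμ : autSeries μ ≠ 0) :
    Tendsto (fun n => (totalAutCount (hasBranch B) n μ : ℝ) /
      totalAutCount (fun _ => True) n μ) atTop
      (𝓝 (1 / (2 ^ B.size * ((isos B B).card : ℝ)))) := by
  have key := (branchSystem.tendsto_branch hμ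
    (fun ν => (totalAutCount (fun l => normalize l = normalize B) B.size ν : ℝ)) (fun ν hν h0 => by
      have h1 : PowerSeries.coeff B.size (autSeries ν) = 0 := by rw [h0, map_zero]
      rw [autSeries, PowerSeries.coeff_mk, Nat.cast_eq_zero] at h1
      have h2 := totalAutCount_le (fun l => normalize l = normalize B) B.size ν
      exact hν (by rw [Nat.cast_eq_zero]; omega)) B.size).const_mul 2
  have hlim : 2 * ((totalAutCount (fun l => normalize l = normalize B) B.size 0 : ℝ) *
      (1 / 4) ^ B.size) = 1 / (2 ^ B.size * ((isos B B).card : ℝ)) := by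
    have h1 := totalAutCount_zero_mul B
    have h2 : 0 < (isos B B).card := Finset.card_pos.mpr ⟨_, refl_mem_isos B⟩
    have h3 : ((isos B B).card : ℝ) ≠ 0 := by positivity
    have h4 : (totalAutCount (fun l => normalize l = normalize B) B.size 0 : ℝ) =
        2 ^ (B.size - 1) / (isos B B).card := by
      rw [eq_div_iff h3]; exact_mod_cast h1
    obtain ⟨m, hm⟩ := Nat.exists_eq_add_of_lt (size_pos B)
    rw [h4, hm, zero_add, Nat.add_sub_cancel, show (4 : ℝ) = 2 * 2 by norm_num]
    field_simp
    have h5 : (1 / 2 ^ 2 : ℝ) ^ (m + 1) * 2 ^ (m + 1) * 2 ^ (m + 1) = 1 := by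
      rw [← mul_pow, ← mul_pow]; norm_num
    rw [← pow_succ']
    linear_combination h5
  rw [hlim] at key
  refine key.congr' ?_
  filter_upwards [eventually_gt_atTop (2 * B.size)] with n hn
  rw [totalAutCount_hasBranch B hn]
  simp only [autSeries, PowerSeries.coeff_mk]
  push_cast
  rw [mul_div_assoc]

end PTree

theorem Nat.pow_mul_factorial_le_pow_mul_descFactorial {n k : ℕ} (h : k ≤ n) :
    n ^ k * k ! ≤ k ^ k * n.descFactorial k := by
  rw [← Nat.descFactorial_self, Nat.descFactorial_eq_prod_range, Nat.descFactorial_eq_prod_range,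
    Finset.pow_eq_prod_const, Finset.pow_eq_prod_const,
    ← Finset.prod_mul_distrib, ← Finset.prod_mul_distrib]
  refine Finset.prod_le_prod' fun i hi => ?_
  have hi := Finset.mem_range.mp hi
  rw [Nat.mul_sub, Nat.mul_sub, mul_comm n k]
  exact Nat.sub_le_sub_left (Nat.mul_le_mul_right i h) _

theorem Multiset.prod_le_two_pow_sum (μ : Multiset ℕ) : μ.prod ≤ 2 ^ μ.sum := by
  induction μ using Multiset.induction_on with
  | empty => simp
  | cons a s ih =>
    rw [Multiset.prod_cons, Multiset.sum_cons, pow_add]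
    exact Nat.mul_le_mul a.lt_two_pow_self.le ih

theorem two_mul_card_le_sum {μ : Multiset ℕ} (h : ∀ i ∈ μ, 2 ≤ i) : 2 * μ.card ≤ μ.sum := by
  rw [mul_comm]
  exact Multiset.card_nsmul_le_sum h

theorem centralizerCard_le {n k : ℕ} {μ : Multiset ℕ} (hμ : μ ∈ cycleTypes k) :
    centralizerCard n μ ≤ (n - k)! * 2 ^ k * (k / 2)! := by
  obtain ⟨rfl, h2⟩ := mem_cycleTypes.mp hμ
  rw [centralizerCard]
  refine Nat.mul_le_mul (Nat.mul_le_mul le_rfl μ.prod_le_two_pow_sum) ?_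
  refine (Nat.le_of_dvd (Nat.factorial_pos _) (Nat.prod_factorial_dvd_factorial_sum _ _)).trans ?_
  rw [Multiset.toFinset_sum_count_eq]
  have := two_mul_card_le_sum h2
  exact Nat.factorial_le (by omega)

theorem summable_pow_mul_half_factorial_div (c : ℝ) (hc : 0 ≤ c) :
    Summable fun k : ℕ => c ^ k * (k / 2)! / k ! := by
  have h1 : Summable fun k : ℕ => c ^ k / (k / 2)! := by
    refine Summable.even_add_odd ?_ ?_
    · refine (Real.summable_pow_div_factorial (c ^ 2)).congr fun m => ?_
      rw [Nat.mul_div_cancel_left m two_pos, pow_mul]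
    · refine ((Real.summable_pow_div_factorial (c ^ 2)).mul_left c).congr fun m => ?_
      rw [show (2 * m + 1) / 2 = m by omega, pow_succ' c (2 * m), pow_mul,
        mul_div_assoc]
  refine h1.of_nonneg_of_le (fun k => by positivity) fun k => ?_
  rw [div_le_div_iff₀ (by positivity) (by positivity), mul_assoc]
  refine mul_le_mul_of_nonneg_left ?_ (by positivity)
  have h3 := Nat.le_of_dvd (Nat.factorial_pos _)
    (Nat.factorial_mul_factorial_dvd_factorial_add (k / 2) (k - k / 2))
  rw [show k / 2 + (k - k / 2) = k by omega] at h3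
  have h4 : (k / 2)! ≤ (k - k / 2)! := Nat.factorial_le (by omega)
  exact_mod_cast (Nat.mul_le_mul le_rfl h4).trans h3

namespace PTree

/-- The generating polynomial of the automorphisms of trees of size `n`, by number of
leaves moved, is dominated by a power. -/
theorem sum_pow_sum_cycleType_le {y : ℝ} (hy : 0 ≤ y) (hy' : y ≤ 1 / 2) {n : ℕ} (hn : 0 < n) :
    ∑ T ∈ planeTrees n, ∑ a ∈ isos T T, y ^ (Equiv.Perm.cycleType (α := Leaves T) a).sum ≤
      (planeTrees n).card * (1 + 4 * y ^ 2) ^ (n - 1) := by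
  induction n using Nat.strong_induction_on with
  | _ n ih =>
    rcases Nat.lt_or_ge 1 n with h1 | h1
    · have hx : 1 ≤ 1 + 4 * y ^ 2 := by nlinarith [sq_nonneg y]
      have hcard : ((planeTrees n).card : ℝ) = ∑ p ∈ Finset.HasAntidiagonal.antidiagonal n,
          ((planeTrees p.1).card : ℝ) * (planeTrees p.2).card := by
        rw [Finset.card_eq_sum_ones, sum_planeTrees, if_neg h1.ne', zero_add]
        simp
      rw [sum_planeTrees, if_neg h1.ne', zero_add, hcard, Finset.sum_mul]
      refine Finset.sum_le_sum fun p hp => ?_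
      have hp := Finset.HasAntidiagonal.mem_antidiagonal.mp hp
      rcases Nat.eq_zero_or_pos p.1 with h2 | h2
      · simp [h2, planeTrees_zero]
      rcases Nat.eq_zero_or_pos p.2 with h3 | h3
      · simp [h3, planeTrees_zero]
      have e1 := ih p.1 (by omega) h2
      have e2 := ih p.2 (by omega) h3
      have hs : ∀ l ∈ planeTrees p.1, ∀ r ∈ planeTrees p.2,
          ∑ a ∈ isos (node l r) (node l r),
            y ^ (Equiv.Perm.cycleType (α := Leaves (node l r)) a).sum ≤
          (∑ g ∈ isos l l, y ^ (Equiv.Perm.cycleType (α := Leaves l) g).sum) *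
            (∑ h ∈ isos r r, y ^ (Equiv.Perm.cycleType (α := Leaves r) h).sum) + y ^ 2 := by
        intro l hl r hr
        have hl := mem_planeTrees.mp hl
        have hr := mem_planeTrees.mp hr
        rw [sum_isos_node]
        simp only [cycleType_straight, sum_cycleType_crossed, Multiset.sum_add, pow_add,
          Finset.sum_mul_sum]
        refine add_le_add le_rfl ?_
        simp only [Finset.sum_const, nsmul_eq_mul]
        have c1 : ((isos l r).card : ℝ) ≤ 2 ^ (p.1 - 1) := by
          have := card_isos_le l r
          rw [hl] at this; exact_mod_cast this
        have c2 : ((isos r l).card : ℝ) ≤ 2 ^ (p.2 - 1) := by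
          have := card_isos_le r l
          rw [hr] at this; exact_mod_cast this
        have c3 : y ^ (node l r).size = y ^ 2 * (y ^ (p.1 - 1) * y ^ (p.2 - 1)) := by
          rw [← pow_add, ← pow_add, size, hl, hr]; congr 1; omega
        calc ((isos l r).card : ℝ) * ((isos r l).card * y ^ (node l r).size)
            ≤ 2 ^ (p.1 - 1) * (2 ^ (p.2 - 1) * y ^ (node l r).size) := by gcongr
          _ = y ^ 2 * ((2 * y) ^ (p.1 - 1) * (2 * y) ^ (p.2 - 1)) := by
            rw [c3, mul_pow, mul_pow]; ring
          _ ≤ y ^ 2 * (1 * 1) := by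
            gcongr <;> exact pow_le_one₀ (by linarith) (by linarith)
          _ = y ^ 2 := by ring
      calc _ ≤ ∑ l ∈ planeTrees p.1, ∑ r ∈ planeTrees p.2,
          ((∑ g ∈ isos l l, y ^ (Equiv.Perm.cycleType (α := Leaves l) g).sum) *
            (∑ h ∈ isos r r, y ^ (Equiv.Perm.cycleType (α := Leaves r) h).sum) + y ^ 2) :=
            Finset.sum_le_sum fun l hl => Finset.sum_le_sum fun r hr => hs l hl r hr
        _ = (∑ l ∈ planeTrees p.1, ∑ g ∈ isos l l,
              y ^ (Equiv.Perm.cycleType (α := Leaves l) g).sum) *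
            (∑ r ∈ planeTrees p.2, ∑ h ∈ isos r r,
              y ^ (Equiv.Perm.cycleType (α := Leaves r) h).sum) +
            (planeTrees p.1).card * (planeTrees p.2).card * y ^ 2 := by
          simp only [Finset.sum_add_distrib, Finset.sum_const, nsmul_eq_mul]
          rw [Finset.sum_mul_sum (planeTrees p.1), mul_assoc]
        _ ≤ ((planeTrees p.1).card * (1 + 4 * y ^ 2) ^ (p.1 - 1)) *
            ((planeTrees p.2).card * (1 + 4 * y ^ 2) ^ (p.2 - 1)) +
            (planeTrees p.1).card * (planeTrees p.2).card * y ^ 2 := by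
          gcongr
        _ = (planeTrees p.1).card * (planeTrees p.2).card *
            ((1 + 4 * y ^ 2) ^ (n - 2) + y ^ 2) := by
          rw [show n - 2 = (p.1 - 1) + (p.2 - 1) by omega, pow_add]; ring
        _ ≤ (planeTrees p.1).card * (planeTrees p.2).card * (1 + 4 * y ^ 2) ^ (n - 1) := by
          refine mul_le_mul_of_nonneg_left ?_ (by positivity)
          rw [show n - 1 = n - 2 + 1 by omega, pow_succ (1 + 4 * y ^ 2)]
          have := one_le_pow₀ hx (n := n - 2)
          nlinarith [sq_nonneg y]
    · obtain rfl : n = 1 := by omega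
      rw [planeTrees_one, Finset.sum_singleton, isos, Finset.sum_singleton]
      have : Equiv.Perm.cycleType (α := Leaves leaf) (Equiv.refl _) = 0 :=
        Equiv.Perm.cycleType_one
      rw [this]
      simp

theorem sum_totalAutCount_mul_pow_le (n k : ℕ) {y : ℝ} (hy : 0 ≤ y) :
    (∑ μ ∈ cycleTypes k, totalAutCount (fun _ => True) n μ : ℕ) * y ^ k ≤
      ∑ T ∈ planeTrees n, ∑ a ∈ isos T T,
        y ^ (Equiv.Perm.cycleType (α := Leaves T) a).sum := by
  simp only [totalAutCount, Finset.filter_true]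
  rw [Finset.sum_comm]
  push_cast
  rw [Finset.sum_mul]
  refine Finset.sum_le_sum fun T _ => ?_
  simp only [autCount_eq_sum]
  rw [← Nat.cast_sum, Finset.sum_comm, Nat.cast_sum, Finset.sum_mul]
  refine Finset.sum_le_sum fun a _ => ?_
  rw [Finset.sum_ite_eq]
  split_ifs with h
  · rw [(mem_cycleTypes.mp h).1, Nat.cast_one, one_mul]
  · rw [Nat.cast_zero, zero_mul]
    positivity

theorem sq_sum_totalAutCount_le {n k : ℕ} (hk : 0 < k) (hkn : k ≤ n) :
    ((∑ μ ∈ cycleTypes k, totalAutCount (fun _ => True) n μ : ℕ) : ℝ) ^ 2 * k ! ≤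
      (planeTrees n).card ^ 2 * ((4 * Real.exp 2) ^ k * n.descFactorial k) := by
  have hn : 0 < n := hk.trans_le hkn
  have hn' : (0 : ℝ) < n := by exact_mod_cast hn
  have hk' : (0 : ℝ) < k := by exact_mod_cast hk
  have hkn' : (k : ℝ) ≤ n := by exact_mod_cast hkn
  set H := ((∑ μ ∈ cycleTypes k, totalAutCount (fun _ => True) n μ : ℕ) : ℝ) with hH
  set P := ((planeTrees n).card : ℝ)
  have hP : 0 ≤ P := Nat.cast_nonneg _
  set y := Real.sqrt (k / (4 * n)) with hy
  have hy2 : y ^ 2 = k / (4 * n) := Real.sq_sqrt (by positivity)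
  have hy0 : 0 ≤ y := Real.sqrt_nonneg _
  have hy1 : y ≤ 1 / 2 := by
    refine abs_le_of_sq_le_sq' ?_ (by norm_num) |>.2
    rw [hy2, div_le_iff₀ (by positivity)]
    linarith
  have h1 : H * y ^ k ≤ P * Real.exp k := by
    refine (sum_totalAutCount_mul_pow_le n k hy0).trans
      ((sum_pow_sum_cycleType_le hy0 hy1 hn).trans (mul_le_mul_of_nonneg_left ?_ hP))
    have h2 : 1 + 4 * y ^ 2 ≤ Real.exp (k / n) := by
      rw [hy2, show 4 * ((k : ℝ) / (4 * n)) = k / n by field_simp, add_comm]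
      exact Real.add_one_le_exp _
    calc (1 + 4 * y ^ 2) ^ (n - 1) ≤ (1 + 4 * y ^ 2) ^ n :=
          pow_le_pow_right₀ (by nlinarith [sq_nonneg y]) (by omega)
      _ ≤ Real.exp (k / n) ^ n := by gcongr
      _ = Real.exp k := by rw [← Real.exp_nat_mul]; congr 1; field_simp
  have h3 : H ^ 2 * k ^ k ≤ P ^ 2 * ((4 * Real.exp 2) ^ k * n ^ k) := by
    have h4 : (H * y ^ k) ^ 2 ≤ (P * Real.exp k) ^ 2 :=
      pow_le_pow_left₀ (by positivity) h1 2
    rw [mul_pow, mul_pow, ← pow_mul, mul_comm k 2, pow_mul, hy2, div_pow, mul_pow,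
      ← mul_div_assoc, div_le_iff₀ (by positivity)] at h4
    refine h4.trans (le_of_eq ?_)
    rw [mul_pow, ← Real.exp_nat_mul, ← Real.exp_nat_mul]
    push_cast
    rw [mul_comm (2 : ℝ) k]
    ring
  have h5 : (n : ℝ) ^ k * k ! ≤ k ^ k * n.descFactorial k := by
    exact_mod_cast Nat.pow_mul_factorial_le_pow_mul_descFactorial hkn
  refine le_of_mul_le_mul_right ?_ (show (0 : ℝ) < k ^ k by positivity)
  calc H ^ 2 * k ! * k ^ k = H ^ 2 * k ^ k * k ! := by ring
    _ ≤ P ^ 2 * ((4 * Real.exp 2) ^ k * n ^ k) * k ! := by gcongr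
    _ = P ^ 2 * (4 * Real.exp 2) ^ k * (n ^ k * k !) := by ring
    _ ≤ P ^ 2 * (4 * Real.exp 2) ^ k * (k ^ k * n.descFactorial k) := by gcongr
    _ = _ := by ring

/-- The contribution of a cycle type to the number of tanglegrams, suitably normalized. -/
noncomputable def typeWeight (n : ℕ) (μ : Multiset ℕ) : ℝ :=
  centralizerCard n μ * (totalAutCount (fun _ => True) n μ : ℝ) ^ 2 /
    (n ! * (planeTrees n).card ^ 2)

theorem typeWeight_nonneg (n : ℕ) (μ : Multiset ℕ) : 0 ≤ typeWeight n μ := by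
  rw [typeWeight]; positivity

theorem card_planeTrees_pos {n : ℕ} (hn : 0 < n) : 0 < (planeTrees n).card := by
  induction n, hn using Nat.le_induction with
  | base => rw [planeTrees_one]; simp
  | succ n _ ih =>
    obtain ⟨T, hT⟩ := Finset.card_pos.mp ih
    exact Finset.card_pos.mpr ⟨node T leaf, mem_planeTrees.mpr (by
      rw [size, mem_planeTrees.mp hT, size])⟩

theorem typeWeight_zero {n : ℕ} (hn : 0 < n) : typeWeight n 0 = 1 := by
  have hP : (0 : ℝ) < (planeTrees n).card := by exact_mod_cast card_planeTrees_pos hn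
  have h1 : centralizerCard n 0 = n ! := by simp [centralizerCard]
  have h2 : totalAutCount (fun _ => True) n 0 = (planeTrees n).card := by
    simp [totalAutCount, autCount_zero]
  rw [typeWeight, h1, h2, div_self (by positivity)]

theorem cycleTypes_zero : cycleTypes 0 = {0} := by
  ext μ
  rw [mem_cycleTypes, Finset.mem_singleton]
  constructor
  · rintro ⟨h, h2⟩
    refine Multiset.eq_zero_of_forall_notMem fun i hi => ?_
    have := Multiset.le_sum_of_mem hi
    have := h2 i hi
    omega
  · rintro rfl
    simp

theorem sum_typeWeight_le {n k : ℕ} (hn : 0 < n) (hkn : k ≤ n) :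
    ∑ μ ∈ cycleTypes k, typeWeight n μ ≤ (8 * Real.exp 2) ^ k * (k / 2)! / k ! := by
  rcases Nat.eq_zero_or_pos k with rfl | hk
  · rw [cycleTypes_zero, Finset.sum_singleton, typeWeight_zero hn]
    simp
  have hP : (0 : ℝ) < (planeTrees n).card := by exact_mod_cast card_planeTrees_pos hn
  set H := ((∑ μ ∈ cycleTypes k, totalAutCount (fun _ => True) n μ : ℕ) : ℝ) with hH
  have h1 : ∑ μ ∈ cycleTypes k,
      (centralizerCard n μ : ℝ) * (totalAutCount (fun _ => True) n μ : ℝ) ^ 2 ≤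
      ((n - k)! * 2 ^ k * (k / 2)! : ℕ) * H ^ 2 := by
    calc _ ≤ ∑ μ ∈ cycleTypes k, (((n - k)! * 2 ^ k * (k / 2)! : ℕ) : ℝ) *
          (totalAutCount (fun _ => True) n μ : ℝ) ^ 2 :=
          Finset.sum_le_sum fun μ hμ => mul_le_mul_of_nonneg_right
            (Nat.cast_le.mpr (centralizerCard_le hμ)) (sq_nonneg _)
      _ ≤ _ := by
        rw [← Finset.mul_sum, hH, Nat.cast_sum]
        exact mul_le_mul_of_nonneg_left
          (Finset.sum_sq_le_sq_sum_of_nonneg fun _ _ => Nat.cast_nonneg _) (Nat.cast_nonneg _)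
  have h2 := sq_sum_totalAutCount_le hk hkn
  rw [← hH] at h2
  have h3 : (((n - k)! : ℕ) : ℝ) * n.descFactorial k = n ! := by
    exact_mod_cast Nat.factorial_mul_descFactorial hkn
  simp only [typeWeight]
  rw [← Finset.sum_div, div_le_div_iff₀ (by positivity) (by positivity)]
  calc _ ≤ ((n - k)! * 2 ^ k * (k / 2)! : ℕ) * H ^ 2 * k ! := by gcongr
    _ = ((n - k)! * 2 ^ k * (k / 2)! : ℕ) * (H ^ 2 * k !) := by ring
    _ ≤ ((n - k)! * 2 ^ k * (k / 2)! : ℕ) *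
        ((planeTrees n).card ^ 2 * ((4 * Real.exp 2) ^ k * n.descFactorial k)) := by gcongr
    _ = (2 ^ k * (4 * Real.exp 2) ^ k) * (k / 2)! *
        ((((n - k)! : ℕ) : ℝ) * n.descFactorial k * (planeTrees n).card ^ 2) := by
      push_cast; ring
    _ = _ := by rw [h3, ← mul_pow, ← mul_assoc 2 4]; norm_num

end PTree

namespace PTree

open Filter Topology
theorem filter_tangleClasses_eq_self {n : ℕ} {P : PTree × PTree × List ℕ → Prop}
    (hP : ∀ t, P t) : ((tangleClasses n).filter fun c => ∃ t ∈ c, P t) = tangleClasses n := by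
  refine Finset.filter_eq_self.mpr fun c hc => ?_
  obtain ⟨t, ht, rfl⟩ := Finset.mem_image.mp hc
  exact ⟨t, Finset.mem_filter.mpr ⟨ht, (equivTriple_iff ht ht).mpr (links_self ht)⟩, hP t⟩

theorem numTanglegrams_mul (n : ℕ) : numTanglegrams n * (2 ^ (n - 1) * 2 ^ (n - 1)) =
    ∑ k ∈ Finset.range (n + 1), ∑ μ ∈ cycleTypes k, centralizerCard n μ *
      (totalAutCount (fun _ => True) n μ * totalAutCount (fun _ => True) n μ) := by
  refine Eq.trans ?_ ((card_tangleClasses_mul n (fun _ => True) fun _ _ _ _ => trivial).trans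
    (sum_card_links_eq n fun _ => True))
  exact congrArg (fun s => Finset.card s * _) (filter_tangleClasses_eq_self fun _ => trivial).symm

/-- The contribution of a cycle type to the number of tanglegrams whose left tree has a root
branch isomorphic to `B`, normalized like `typeWeight`. -/
noncomputable def branchWeight (B : PTree) (n : ℕ) (μ : Multiset ℕ) : ℝ :=
  centralizerCard n μ * ((totalAutCount (hasBranch B) n μ : ℝ) *
    totalAutCount (fun _ => True) n μ) / (n ! * (planeTrees n).card ^ 2)

theorem branchWeight_nonneg (B : PTree) (n : ℕ) (μ : Multiset ℕ) : 0 ≤ branchWeight B n μ := by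
  rw [branchWeight]; positivity

theorem branchWeight_le (B : PTree) (n : ℕ) (μ : Multiset ℕ) :
    branchWeight B n μ ≤ typeWeight n μ := by
  rw [branchWeight, typeWeight, sq (totalAutCount _ n μ : ℝ)]
  have : (totalAutCount (hasBranch B) n μ : ℝ) ≤ totalAutCount (fun _ => True) n μ :=
    Nat.cast_le.mpr (totalAutCount_le _ n μ)
  gcongr

theorem tangleProb_hasBranch (B : PTree) {n : ℕ} (hn : 0 < n) :
    tangleProb n (fun t => hasBranch B t.1) =
      (∑ k ∈ Finset.range (n + 1), ∑ μ ∈ cycleTypes k, branchWeight B n μ) /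
      ∑ k ∈ Finset.range (n + 1), ∑ μ ∈ cycleTypes k, typeWeight n μ := by
  have hP : (0 : ℝ) < (planeTrees n).card := by exact_mod_cast card_planeTrees_pos hn
  have hc : (2 ^ (n - 1) * 2 ^ (n - 1) : ℝ) ≠ 0 := by positivity
  have hd : ((n ! : ℝ) * (planeTrees n).card ^ 2) ≠ 0 := by positivity
  have h1 := (card_tangleClasses_mul n (fun t => hasBranch B t.1)
    fun t t' ⟨e, he⟩ h => hasBranch_of_mem_isos he h).trans (sum_card_links_eq n (hasBranch B))
  have h2 := numTanglegrams_mul n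
  rw [tangleProb, ← mul_div_mul_right _ _ hc]
  have h1' := congrArg (Nat.cast (R := ℝ)) h1
  have h2' := congrArg (Nat.cast (R := ℝ)) h2
  push_cast at h1' h2'
  rw [h1', h2']
  simp only [branchWeight, typeWeight, ← Finset.sum_div, sq (totalAutCount _ n _ : ℝ)]
  rw [div_div_div_cancel_right₀ hd]

theorem typeWeight_le {n k : ℕ} (hn : 0 < n) (hkn : k ≤ n) {μ : Multiset ℕ}
    (hμ : μ ∈ cycleTypes k) : typeWeight n μ ≤ (8 * Real.exp 2) ^ k * (k / 2)! / k ! :=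
  (Finset.single_le_sum (f := typeWeight n) (fun _ _ => typeWeight_nonneg n _) hμ).trans
    (sum_typeWeight_le hn hkn)

theorem tendsto_branchWeight_sub (B : PTree) (μ : Multiset ℕ) {k : ℕ} (hμ : μ ∈ cycleTypes k) :
    Tendsto (fun n => branchWeight B n μ -
      1 / (2 ^ B.size * ((isos B B).card : ℝ)) * typeWeight n μ) atTop (𝓝 0) := by
  set p := 1 / (2 ^ B.size * ((isos B B).card : ℝ))
  by_cases h : autSeries μ = 0
  · refine tendsto_const_nhds.congr fun n => ?_
    have h1 : (totalAutCount (fun _ => True) n μ : ℝ) = 0 := by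
      have := congrArg (PowerSeries.coeff n) h
      rwa [autSeries, PowerSeries.coeff_mk, map_zero] at this
    rw [branchWeight, typeWeight, h1]
    simp
  · have h1 := ((tendsto_hasBranch_ratio B h).sub_const p).norm.const_mul
      ((8 * Real.exp 2) ^ k * (k / 2)! / k !)
    rw [sub_self, norm_zero, mul_zero] at h1
    refine squeeze_zero_norm' ?_ h1
    filter_upwards [branchSystem.eventually_pos h, eventually_gt_atTop 0, eventually_ge_atTop k]
      with n h2 h3 h4
    rw [autSeries, PowerSeries.coeff_mk] at h2
    have h5 : branchWeight B n μ - p * typeWeight n μ = typeWeight n μ *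
        ((totalAutCount (hasBranch B) n μ : ℝ) / totalAutCount (fun _ => True) n μ - p) := by
      rw [branchWeight, typeWeight]
      field_simp
    rw [h5, norm_mul, Real.norm_of_nonneg (typeWeight_nonneg n μ)]
    exact mul_le_mul_of_nonneg_right (typeWeight_le h3 h4 hμ) (norm_nonneg _)

theorem tendsto_sum_branchWeight_sub (B : PTree) :
    Tendsto (fun n => ∑ k ∈ Finset.range (n + 1), ∑ μ ∈ cycleTypes k, (branchWeight B n μ -
      1 / (2 ^ B.size * ((isos B B).card : ℝ)) * typeWeight n μ)) atTop (𝓝 0) := by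
  set p := 1 / (2 ^ B.size * ((isos B B).card : ℝ)) with hp
  have hp0 : 0 ≤ p := by positivity
  have key := tendsto_tsum_of_dominated_convergence (𝓕 := atTop)
    (f := fun n k : ℕ => if k ∈ Finset.range (n + 1) then
      ∑ μ ∈ cycleTypes k, (branchWeight B n μ - p * typeWeight n μ) else 0)
    (g := fun _ => (0 : ℝ))
    ((summable_pow_mul_half_factorial_div (8 * Real.exp 2) (by positivity)).mul_left (1 + p))
    (fun k => ?_) ?_
  · rw [tsum_zero] at key
    refine key.congr fun n => ?_
    rw [tsum_eq_sum (s := Finset.range (n + 1)) fun k hk => if_neg hk]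
    exact Finset.sum_congr rfl fun k hk => if_pos hk
  · have h1 : Tendsto (fun n => ∑ μ ∈ cycleTypes k, (branchWeight B n μ - p * typeWeight n μ))
        atTop (𝓝 (∑ μ ∈ cycleTypes k, 0)) :=
      tendsto_finsetSum _ fun μ hμ => tendsto_branchWeight_sub B μ hμ
    rw [Finset.sum_const_zero] at h1
    refine h1.congr' ?_
    filter_upwards [eventually_ge_atTop k] with n hn
    rw [if_pos (Finset.mem_range.mpr (by omega))]
  · filter_upwards [eventually_gt_atTop 0] with n hn k
    split_ifs with hk
    · refine (norm_sum_le _ _).trans (le_trans ?_ (mul_le_mul_of_nonneg_left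
        (sum_typeWeight_le hn (Nat.lt_succ_iff.mp (Finset.mem_range.mp hk))) (by linarith)))
      rw [Finset.mul_sum]
      refine Finset.sum_le_sum fun μ _ => ?_
      rw [Real.norm_eq_abs, abs_le]
      have h1 := branchWeight_nonneg B n μ
      have h2 := branchWeight_le B n μ
      have h3 := mul_nonneg hp0 (typeWeight_nonneg n μ)
      constructor <;> linarith
    · rw [norm_zero]
      positivity

theorem tendsto_tangleProb_hasBranch (B : PTree) :
    Tendsto (fun n => tangleProb n (fun t => hasBranch B t.1)) atTop
      (𝓝 (1 / (2 ^ B.size * ((isoFuns B B).length : ℝ)))) := by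
  rw [length_isoFuns, tendsto_iff_norm_sub_tendsto_zero]
  have h := (tendsto_sum_branchWeight_sub B).norm
  rw [norm_zero] at h
  refine squeeze_zero' (Eventually.of_forall fun _ => norm_nonneg _) ?_ h
  filter_upwards [eventually_gt_atTop 0] with n hn
  rw [tangleProb_hasBranch B hn]
  set p := 1 / (2 ^ B.size * ((isos B B).card : ℝ))
  set τ := ∑ k ∈ Finset.range (n + 1), ∑ μ ∈ cycleTypes k, typeWeight n μ with hτ
  have h1 : 1 ≤ τ := by
    have h2 := Finset.single_le_sum (f := fun k => ∑ μ ∈ cycleTypes k, typeWeight n μ)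
      (fun k _ => Finset.sum_nonneg fun μ _ => typeWeight_nonneg n μ)
      (Finset.mem_range.mpr (Nat.succ_pos n))
    rwa [cycleTypes_zero, Finset.sum_singleton, typeWeight_zero hn] at h2
  have h3 : ∑ k ∈ Finset.range (n + 1), ∑ μ ∈ cycleTypes k,
      (branchWeight B n μ - p * typeWeight n μ) =
      (∑ k ∈ Finset.range (n + 1), ∑ μ ∈ cycleTypes k, branchWeight B n μ) - p * τ := by
    simp only [hτ, Finset.sum_sub_distrib, Finset.mul_sum]
  rw [h3, div_sub' (by positivity), norm_div, mul_comm τ p, Real.norm_of_nonneg (r := τ)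
    (by linarith)]
  exact div_le_self (norm_nonneg _) h1

end PTree

end

open PTree in
/-- Corollary 5: the limiting probability that a fixed binary tree `B` occurs as one of
the two root branches of the left tree of a random tanglegram is `2^(-|B|)/|A(B)|`;
in particular, the limiting probability that a root branch is a single leaf is `1/2`. -/
theorem root_branch_probability :
    (∀ B : PTree, Filter.Tendsto
      (fun n : ℕ => tangleProb n (fun t => hasBranch B t.1))
      Filter.atTop (nhds (1 / (2 ^ B.size * ((isoFuns B B).length : ℝ))))) ∧
    Filter.Tendsto
      (fun n : ℕ => tangleProb n (fun t => hasBranch leaf t.1))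
      Filter.atTop (nhds (1 / 2)) := by
  refine ⟨tendsto_tangleProb_hasBranch, ?_⟩
  have h := tendsto_tangleProb_hasBranch leaf
  simpa [isoFuns, size] using h
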